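/- arXiv:1607.07380 — 3 statements merged into one kernel-verified Lean document; each statement's English description precedes it below -/
import Mathlib

section
/- Let $R$ and $S$ be commutative algebras over a field $k$, $I \subseteq R$ and $J \subseteq S$ ideals, $T = R \otimes_k S$, $P = I + J$. Then for all non-negative integers $r, s$ and all $0 \le i \le s$, one has $I^{r+i}J^{s-i} \cap I^r P^{s+1} = I^{r+i+1}J^{s-i} + I^{r+i}J^{s-i+1}$ as ideals of $T$. -/
open TensorProduct

/-- The product of the extensions of `A` and `B` to `R ⊗[k] S` is contained in every `k`-submodule
that contains all pure tensors `a ⊗ₜ b` with `a ∈ A` and `b ∈ B`. -/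
theorem Ideal.map_mul_map_le_of_tmul_mem {k R S : Type*} [CommRing k] [CommRing R] [CommRing S]
    [Algebra k R] [Algebra k S] {A : Ideal R} {B : Ideal S} {N : Submodule k (R ⊗[k] S)}
    (h : ∀ a ∈ A, ∀ b ∈ B, a ⊗ₜ[k] b ∈ N) {x : R ⊗[k] S}
    (hx : x ∈ A.map (algebraMap R (R ⊗[k] S)) * B.map
      ((Algebra.TensorProduct.includeRight : S →ₐ[k] R ⊗[k] S) : S →+* R ⊗[k] S)) : x ∈ N := by
  rw [Ideal.map, Ideal.map, Ideal.span_mul_span'] at hx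
  induction hx using Submodule.closure_induction with
  | zero => exact N.zero_mem
  | add x y _ _ hx hy => exact N.add_mem hx hy
  | smul_mem t x hx =>
    obtain ⟨_, ⟨a, ha, rfl⟩, _, ⟨b, hb, rfl⟩, rfl⟩ := hx
    induction t using TensorProduct.induction_on with
    | zero => simp
    | tmul p q => simpa using h _ (A.mul_mem_left p ha) _ (B.mul_mem_left q hb)
    | add x y hx hy => rw [add_smul]; exact N.add_mem hx hy

/-- A subspace of a vector space is the image of a linear projection. -/
theorem Submodule.exists_linearMap_mem_and_eq_self {k V : Type*} [Field k] [AddCommGroup V]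
    [Module k V] (W : Submodule k V) :
    ∃ f : V →ₗ[k] V, (∀ v, f v ∈ W) ∧ ∀ w ∈ W, f w = w := by
  obtain ⟨g, hg⟩ := W.subtype.exists_leftInverse_of_injective W.ker_subtype
  refine ⟨W.subtype ∘ₗ g, fun v ↦ (g v).2, fun w hw ↦ ?_⟩
  simpa using congrArg Subtype.val (LinearMap.congr_fun hg ⟨w, hw⟩)

/-- For ideals `A' ≤ A` of `R` and `B' ≤ B` of `S`, extended to `R ⊗[k] S` over a field `k`,
`A B ⊓ (A' + B') ≤ A' B + A B'`. -/
theorem Ideal.map_mul_map_inf_sup_le {k R S : Type*} [Field k] [CommRing R] [CommRing S]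
    [Algebra k R] [Algebra k S] {A A' : Ideal R} {B B' : Ideal S} (hA : A' ≤ A) (hB : B' ≤ B) :
    letI φ : R →+* R ⊗[k] S := algebraMap R (R ⊗[k] S)
    letI ψ : S →+* R ⊗[k] S := (Algebra.TensorProduct.includeRight : S →ₐ[k] R ⊗[k] S)
    A.map φ * B.map ψ ⊓ (A'.map φ ⊔ B'.map ψ) ≤ A'.map φ * B.map ψ ⊔ A.map φ * B'.map ψ := by
  rintro x ⟨hx, hx'⟩
  obtain ⟨f, hf, hf'⟩ := (A.restrictScalars k).exists_linearMap_mem_and_eq_self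
  obtain ⟨g, hg, hg'⟩ := (B.restrictScalars k).exists_linearMap_mem_and_eq_self
  have tmul_mem {C : Ideal R} {D : Ideal S} {a : R} {b : S} (ha : a ∈ C) (hb : b ∈ D) :
      a ⊗ₜ[k] b ∈ C.map (algebraMap R (R ⊗[k] S)) * D.map
        ((Algebra.TensorProduct.includeRight : S →ₐ[k] R ⊗[k] S) : S →+* R ⊗[k] S) := by
    simpa using Ideal.mul_mem_mul (Ideal.mem_map_of_mem (algebraMap R (R ⊗[k] S)) ha)
      (Ideal.mem_map_of_mem
        ((Algebra.TensorProduct.includeRight : S →ₐ[k] R ⊗[k] S) : S →+* R ⊗[k] S) hb)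
  have hfix : x ∈ LinearMap.eqLocus (TensorProduct.map f g) LinearMap.id :=
    Ideal.map_mul_map_le_of_tmul_mem (fun a ha b hb ↦ by simp [hf' a ha, hg' b hb]) hx
  have hfix' : TensorProduct.map f g x = x := hfix
  obtain ⟨u, hu, v, hv, rfl⟩ := Submodule.mem_sup.mp hx'
  rw [← hfix', map_add]
  refine Submodule.add_mem_sup ?_ ?_
  · rw [← Ideal.mul_top (Ideal.map _ A'), ← Ideal.map_top (Algebra.TensorProduct.includeRight :
      S →ₐ[k] R ⊗[k] S).toRingHom] at hu
    exact Ideal.map_mul_map_le_of_tmul_mem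
      (N := ((A'.map (algebraMap R (R ⊗[k] S)) * B.map ((Algebra.TensorProduct.includeRight :
        S →ₐ[k] R ⊗[k] S) : S →+* R ⊗[k] S)).restrictScalars k).comap (TensorProduct.map f g))
      (fun a ha b _ ↦ tmul_mem ((hf' a (hA ha)).symm ▸ ha) (hg b)) hu
  · rw [← Ideal.top_mul (Ideal.map _ B'), ← Ideal.map_top (algebraMap R (R ⊗[k] S))] at hv
    exact Ideal.map_mul_map_le_of_tmul_mem
      (N := ((A.map (algebraMap R (R ⊗[k] S)) * B'.map ((Algebra.TensorProduct.includeRight :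
        S →ₐ[k] R ⊗[k] S) : S →+* R ⊗[k] S)).restrictScalars k).comap (TensorProduct.map f g))
      (fun a _ b hb ↦ tmul_mem (hf a) ((hg' b (hB hb)).symm ▸ hb)) hv

/-- `I ^ r * (I + J) ^ (m + n + 1) ≤ I ^ (r + m + 1) + J ^ (n + 1)`. -/
theorem Ideal.pow_mul_add_pow_le {T : Type*} [CommRing T] (I J : Ideal T) (r m n : ℕ) :
    I ^ r * (I + J) ^ (m + n + 1) ≤ I ^ (r + m + 1) ⊔ J ^ (n + 1) := by
  rw [add_pow, Finset.mul_sum, Ideal.sum_eq_sup]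
  refine Finset.sup_le fun j _ ↦ ?_
  rw [← mul_assoc, ← mul_assoc, ← pow_add]
  refine Ideal.mul_le_left.trans ?_
  rcases Nat.lt_or_ge m j with h | h
  · refine le_sup_of_le_left (Ideal.mul_le_left.trans (Ideal.pow_le_pow_right ?_))
    omega
  · refine le_sup_of_le_right (Ideal.mul_le_right.trans (Ideal.pow_le_pow_right ?_))
    omega

/-- With `T = R ⊗[k] S`, `P = I + J`, for `r s : ℕ` and `0 ≤ i ≤ s`,
`I^(r+i) J^(s-i) ⊓ I^r P^(s+1) = I^(r+i+1) J^(s-i) + I^(r+i) J^(s-i+1)` as ideals of `T`. -/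
theorem inter_with_IrP_succ {k R S : Type*} [Field k] [CommRing R] [CommRing S]
    [Algebra k R] [Algebra k S] (I : Ideal R) (J : Ideal S)
    (I' J' P : Ideal (R ⊗[k] S))
    (hI' : I' = I.map (algebraMap R (R ⊗[k] S)))
    (hJ' : J' = J.map ((Algebra.TensorProduct.includeRight : S →ₐ[k] R ⊗[k] S) : S →+* R ⊗[k] S))
    (hP : P = I' + J') (r s i : ℕ) (hi : i ≤ s) :
    I' ^ (r + i) * J' ^ (s - i) ⊓ I' ^ r * P ^ (s + 1)
      = I' ^ (r + i + 1) * J' ^ (s - i) + I' ^ (r + i) * J' ^ (s - i + 1) := by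
  obtain ⟨n, rfl⟩ := Nat.exists_eq_add_of_le hi
  rw [Nat.add_sub_cancel_left]
  have hIP : I' ≤ P := by rw [hP]; exact le_sup_left
  have hJP : J' ≤ P := by rw [hP]; exact le_sup_right
  have key {a b : ℕ} (h : a + b = i + n + 1) :
      I' ^ (r + a) * J' ^ b ≤ I' ^ r * P ^ (i + n + 1) := by
    rw [pow_add, mul_assoc, ← h, pow_add P]
    exact Ideal.mul_mono_right (Ideal.mul_mono (Ideal.pow_right_mono hIP _)
      (Ideal.pow_right_mono hJP _))
  have hle : I' ^ r * P ^ (i + n + 1) ≤ I' ^ (r + i + 1) ⊔ J' ^ (n + 1) := by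
    rw [hP]; exact Ideal.pow_mul_add_pow_le I' J' r i n
  rw [Submodule.add_eq_sup]
  refine le_antisymm ((inf_le_inf_left _ hle).trans ?_) (sup_le (le_inf ?_ ?_) (le_inf ?_ ?_))
  · rw [hI', hJ']
    simp only [← Ideal.map_pow]
    exact Ideal.map_mul_map_inf_sup_le (Ideal.pow_le_pow_right (Nat.le_succ _))
      (Ideal.pow_le_pow_right (Nat.le_succ _))
  · exact Ideal.mul_mono_left (Ideal.pow_le_pow_right (Nat.le_succ _))
  · exact key (a := i + 1) (by omega)
  · exact Ideal.mul_mono_right (Ideal.pow_le_pow_right (Nat.le_succ _))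
  · exact key (a := i) (by omega)
end

section
/- Let $R$ be a standard graded algebra over a field $k$ with graded maximal ideal $\mathfrak{m}$, and let $P = I + J$ be a decomposition of a homogeneous ideal with $I, J$ non-zero homogeneous ideals. If the decomposition is a Betti splitting, i.e. $\beta_i(P) = \beta_i(I) + \beta_i(J) + \beta_{i-1}(I \cap J)$ for all $i$, then $\operatorname{reg}_R P = \max\{\operatorname{reg}_R I, \operatorname{reg}_R J, \operatorname{reg}_R(I \cap J) - 1\}$. -/
open TensorProduct

section GradedPrelim

variable (k : Type) [Field k]

/-- The `ℤ`-indexed degree pieces of a graded algebra, extending an `ℕ`-grading by zero. -/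
noncomputable def zpiece {R : Type} [CommRing R] [Algebra k R]
    (𝒜 : ℕ → Submodule k R) : ℤ → Submodule k R :=
  fun d => if 0 ≤ d then 𝒜 d.toNat else ⊥

/-- The graded maximal ideal of a graded algebra: the ideal generated by all elements of
positive degree. -/
def gradedMax {R : Type} [CommRing R] [Algebra k R] (𝒜 : ℕ → Submodule k R) : Ideal R :=
  Ideal.span (⋃ n : ℕ, ((𝒜 (n + 1) : Submodule k R) : Set R))

/-- The graded free module with `β i j` basis elements of internal degree `j` in homological
degree `i`. -/
abbrev FreeMod (R : Type) [CommRing R] (β : ℕ → ℤ → ℕ) (i : ℕ) : Type :=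
  ((j : ℤ) × Fin (β i j)) →₀ R

/-- `x` is homogeneous of internal degree `d` in the graded free module `⊕_j R(-j)^(β i j)`:
its coordinate at a basis element of degree `j` lies in the degree `d - j` piece of `R`. -/
def IsHomogEl {R : Type} [CommRing R] [Algebra k R] (𝒜 : ℕ → Submodule k R)
    (β : ℕ → ℤ → ℕ) (i : ℕ) (d : ℤ) (x : FreeMod R β i) : Prop :=
  ∀ p : (j : ℤ) × Fin (β i j), x p ∈ zpiece k 𝒜 (d - p.1)

/-- A minimal graded free resolution of the graded module `(M, ℳ)` over the graded algebra
`(R, 𝒜)`, with graded Betti numbers `β i j`.  It consists of graded free modules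
`F i = ⊕_j R(-j)^(β i j)`, degree-preserving differentials `dd` and augmentation `eps`,
exactness, and minimality (`d(F) ⊆ 𝔪 F`, `ker eps ⊆ 𝔪 F₀`). -/
structure MinimalGradedFreeResolution {R : Type} [CommRing R] [Algebra k R]
    (𝒜 : ℕ → Submodule k R) (β : ℕ → ℤ → ℕ)
    (M : Type) [AddCommGroup M] [Module R M] [Module k M]
    (ℳ : ℤ → Submodule k M) : Type where
  dd : ∀ i : ℕ, (FreeMod R β (i + 1)) →ₗ[R] FreeMod R β i
  eps : FreeMod R β 0 →ₗ[R] M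
  betti_finite : ∀ i, {j : ℤ | β i j ≠ 0}.Finite
  eps_surj : Function.Surjective eps
  exact_zero : LinearMap.ker eps = LinearMap.range (dd 0)
  exact_succ : ∀ i, LinearMap.ker (dd i) = LinearMap.range (dd (i + 1))
  min_eps : LinearMap.ker eps ≤ (gradedMax k 𝒜) • (⊤ : Submodule R (FreeMod R β 0))
  min_d : ∀ i, LinearMap.range (dd i) ≤ (gradedMax k 𝒜) • (⊤ : Submodule R (FreeMod R β i))
  graded_d : ∀ i d x, IsHomogEl k 𝒜 β (i + 1) d x → IsHomogEl k 𝒜 β i d (dd i x)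
  graded_eps : ∀ d x, IsHomogEl k 𝒜 β 0 d x → eps x ∈ ℳ d

/-- The projective dimension of a module, read off from its graded Betti numbers:
`sup {i | β i j ≠ 0 for some j}`, as an element of `ℕ∞`. -/
noncomputable def pdOf (β : ℕ → ℤ → ℕ) : ℕ∞ :=
  sSup {x : ℕ∞ | ∃ (i : ℕ) (j : ℤ), β i j ≠ 0 ∧ x = (i : ℕ∞)}

/-- The (Castelnuovo–Mumford) regularity of a module, read off from its graded Betti numbers:
`sup {j - i | β i j ≠ 0}`, as an element of `EReal`. -/
noncomputable def regOf (β : ℕ → ℤ → ℕ) : EReal :=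
  sSup {x : EReal | ∃ (i : ℕ) (j : ℤ), β i j ≠ 0 ∧ x = ((j - i : ℤ) : ℝ)}

/-- The regularity shifted down by one: `sup {j - i - 1 | β i j ≠ 0}` in `EReal`. -/
noncomputable def regOfSub1 (β : ℕ → ℤ → ℕ) : EReal :=
  sSup {x : EReal | ∃ (i : ℕ) (j : ℤ), β i j ≠ 0 ∧ x = ((j - i - 1 : ℤ) : ℝ)}

/-- The projective dimension shifted up by one: `sup {i + 1 | β i j ≠ 0}` in `ℕ∞`. -/
noncomputable def pdOfAdd1 (β : ℕ → ℤ → ℕ) : ℕ∞ :=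
  sSup {x : ℕ∞ | ∃ (i : ℕ) (j : ℤ), β i j ≠ 0 ∧ x = (i : ℕ∞) + 1}

/-- The `i`-th total Betti number: `β i = ∑ j, β i j`. -/
noncomputable def totalBetti (β : ℕ → ℤ → ℕ) (i : ℕ) : ℕ := ∑ᶠ j : ℤ, β i j

end GradedPrelim

/-- The natural `ℤ`-grading on an ideal `I` of a graded algebra `(R, 𝒜)`, induced by that
of `R`. -/
noncomputable def idealGrading {k : Type} [Field k] {R : Type} [CommRing R] [Algebra k R]
    (𝒜 : ℕ → Submodule k R) (I : Ideal R) : ℤ → Submodule k ↥I :=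
  fun d => Submodule.comap ((I.subtype).restrictScalars k) (zpiece k 𝒜 d)

section GradedModules

variable {k : Type} [Field k] {R : Type} [CommRing R] [Algebra k R] (𝒜 : ℕ → Submodule k R)

/-- The predicates `h d` single out the homogeneous elements of degree `d` of a `ℤ`-graded
module over the graded algebra `(R, 𝒜)`. -/
structure IsGradedModule {Y : Type} [AddCommGroup Y] [Module R Y] (h : ℤ → Y → Prop) : Prop where
  smul_mem : ∀ (n e : ℤ) (r : R) (y : Y), r ∈ zpiece k 𝒜 n → h e y → h (n + e) (r • y)
  exists_proj : ∃ π : ℤ → Y →+ Y, (∀ d y, h d (π d y)) ∧ (∀ d y, h d y → π d y = y) ∧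
    ∀ d e y, h e y → e ≠ d → π d y = 0
  mem_closure : ∀ y, y ∈ AddSubgroup.closure {y | ∃ d, h d y}

/-- A linear map that preserves degrees. -/
def IsDegreePreserving {Y Z : Type} [AddCommGroup Y] [Module R Y] [AddCommGroup Z] [Module R Z]
    (hY : ℤ → Y → Prop) (hZ : ℤ → Z → Prop) (g : Y →ₗ[R] Z) : Prop :=
  ∀ d y, hY d y → hZ d (g y)

/-- The lifting property of graded projective modules with respect to degree-preserving maps. -/
def IsGradedProjective {S : Type} [AddCommGroup S] [Module R S] (h : ℤ → S → Prop) : Prop :=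
  ∀ (Y Z : Type) [AddCommGroup Y] [Module R Y] [AddCommGroup Z] [Module R Z]
    (hY : ℤ → Y → Prop) (hZ : ℤ → Z → Prop) (g : Y →ₗ[R] Z) (w : S →ₗ[R] Z),
    IsGradedModule 𝒜 hY → IsGradedModule 𝒜 hZ → IsDegreePreserving hY hZ g →
    IsDegreePreserving h hZ w → (∀ s, ∃ y, g y = w s) →
    ∃ l : S →ₗ[R] Y, IsDegreePreserving h hY l ∧ ∀ s, g (l s) = w s

/-- The homogeneous elements of a product of graded modules. -/
def prodHomog {Y Z : Type} (hY : ℤ → Y → Prop) (hZ : ℤ → Z → Prop) (d : ℤ) (x : Y × Z) : Prop :=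
  hY d x.1 ∧ hZ d x.2

variable {𝒜}

section

variable {Y Z : Type} [AddCommGroup Y] [Module R Y] [AddCommGroup Z] [Module R Z]
  {hY : ℤ → Y → Prop} {hZ : ℤ → Z → Prop}

theorem IsGradedModule.zero (H : IsGradedModule 𝒜 hY) (d : ℤ) : hY d 0 := by
  obtain ⟨π, h1, -, -⟩ := H.exists_proj
  simpa using h1 d 0

theorem IsGradedModule.add (H : IsGradedModule 𝒜 hY) {d : ℤ} {x y : Y} (hx : hY d x)
    (hy : hY d y) : hY d (x + y) := by
  obtain ⟨π, h1, h2, -⟩ := H.exists_proj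
  simpa [h2 d x hx, h2 d y hy] using h1 d (x + y)

theorem IsGradedModule.neg (H : IsGradedModule 𝒜 hY) {d : ℤ} {x : Y} (hx : hY d x) :
    hY d (-x) := by
  obtain ⟨π, h1, h2, -⟩ := H.exists_proj
  simpa [h2 d x hx] using h1 d (-x)

theorem IsGradedModule.sum (H : IsGradedModule 𝒜 hY) {ι : Type} {d : ℤ} (s : Finset ι)
    (f : ι → Y) (hf : ∀ i ∈ s, hY d (f i)) : hY d (∑ i ∈ s, f i) := by
  classical
  induction s using Finset.induction_on with
  | empty => simpa using H.zero d
  | insert a s ha ih =>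
    rw [Finset.sum_insert ha]
    exact H.add (hf a (by simp)) (ih fun i hi => hf i (by simp [hi]))

theorem IsGradedModule.exists_homog_preimage (HY : IsGradedModule 𝒜 hY)
    (HZ : IsGradedModule 𝒜 hZ) {g : Y →ₗ[R] Z} (hg : IsDegreePreserving hY hZ g) {d : ℤ} {y : Y}
    (hy : hZ d (g y)) : ∃ y', hY d y' ∧ g y' = g y := by
  obtain ⟨π, h1, h2, h3⟩ := HY.exists_proj
  obtain ⟨ρ, k1, k2, k3⟩ := HZ.exists_proj
  refine ⟨π d y, h1 d y, ?_⟩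
  rw [← k2 d _ hy]
  have key := HY.mem_closure y
  clear hy
  induction key using AddSubgroup.closure_induction with
  | mem x hx =>
    obtain ⟨e, he⟩ := hx
    by_cases hed : e = d
    · subst hed; rw [h2 e x he, k2 e _ (hg e x he)]
    · rw [h3 d e x he hed, k3 d e _ (hg e x he) hed, map_zero]
  | zero => simp
  | add a b _ _ ha hb => simp [ha, hb]
  | neg a _ ha => simp [ha]

theorem IsGradedModule.prod (HY : IsGradedModule 𝒜 hY) (HZ : IsGradedModule 𝒜 hZ) :
    IsGradedModule 𝒜 (prodHomog hY hZ) := by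
  refine ⟨fun n e r y hr hy => ⟨HY.smul_mem n e r _ hr hy.1, HZ.smul_mem n e r _ hr hy.2⟩, ?_, ?_⟩
  · obtain ⟨π, h1, h2, h3⟩ := HY.exists_proj
    obtain ⟨ρ, k1, k2, k3⟩ := HZ.exists_proj
    refine ⟨fun d => (π d).prodMap (ρ d), fun d y => ⟨h1 d _, k1 d _⟩, fun d y hy => ?_,
      fun d e y hy hne => ?_⟩
    · exact Prod.ext (h2 d _ hy.1) (k2 d _ hy.2)
    · exact Prod.ext (h3 d e _ hy.1 hne) (k3 d e _ hy.2 hne)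
  · rintro ⟨a, b⟩
    have ha : (a, (0 : Z)) ∈ AddSubgroup.closure {y | ∃ d, prodHomog hY hZ d y} := by
      have := HY.mem_closure a
      induction this using AddSubgroup.closure_induction with
      | mem x hx =>
        obtain ⟨e, he⟩ := hx
        exact AddSubgroup.subset_closure ⟨e, he, HZ.zero e⟩
      | zero => exact zero_mem _
      | add x y _ _ hx hy => simpa using add_mem hx hy
      | neg x _ hx => simpa using neg_mem hx
    have hb : ((0 : Y), b) ∈ AddSubgroup.closure {y | ∃ d, prodHomog hY hZ d y} := by
      have := HZ.mem_closure b
      induction this using AddSubgroup.closure_induction with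
      | mem x hx =>
        obtain ⟨e, he⟩ := hx
        exact AddSubgroup.subset_closure ⟨e, HY.zero e, he⟩
      | zero => exact zero_mem _
      | add x y _ _ hx hy => simpa using add_mem hx hy
      | neg x _ hx => simpa using neg_mem hx
    simpa using add_mem ha hb

theorem IsGradedProjective.prod (GY : IsGradedModule 𝒜 hY) (GZ : IsGradedModule 𝒜 hZ)
    (HY : IsGradedProjective 𝒜 hY) (HZ : IsGradedProjective 𝒜 hZ) :
    IsGradedProjective 𝒜 (prodHomog hY hZ) := by
  intro A B _ _ _ _ hA hB g w GA GB hg hw hr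
  obtain ⟨l, hl, hl'⟩ := HY A B hA hB g (w ∘ₗ LinearMap.inl R Y Z) GA GB hg
    (fun d y hy => hw d _ ⟨hy, GZ.zero d⟩) (fun s => hr _)
  obtain ⟨m, hm, hm'⟩ := HZ A B hA hB g (w ∘ₗ LinearMap.inr R Y Z) GA GB hg
    (fun d y hy => hw d _ ⟨GY.zero d, hy⟩) (fun s => hr _)
  refine ⟨l.coprod m, fun d y hy => ?_, fun s => ?_⟩
  · simpa using GA.add (hl d _ hy.1) (hm d _ hy.2)
  · rw [LinearMap.coprod_apply, map_add, hl', hm', LinearMap.comp_apply, LinearMap.comp_apply,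
      ← map_add]
    simp

end

section

variable [GradedAlgebra 𝒜]

variable (𝒜) in
/-- The projection of a graded algebra onto its `ℤ`-indexed degree pieces. -/
noncomputable def zproj (d : ℤ) : R →+ R := if 0 ≤ d then GradedRing.proj 𝒜 d.toNat else 0

theorem zproj_mem (d : ℤ) (y : R) : zproj 𝒜 d y ∈ zpiece k 𝒜 d := by
  unfold zpiece zproj
  split_ifs with hd
  · simp [GradedRing.proj_apply]
  · simp

theorem zproj_of_mem {d : ℤ} {y : R} (hy : y ∈ zpiece k 𝒜 d) : zproj 𝒜 d y = y := by
  unfold zpiece at hy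
  unfold zproj
  split_ifs at hy ⊢
  · rw [GradedRing.proj_apply, DirectSum.decompose_of_mem_same 𝒜 hy]
  · simp [(Submodule.mem_bot k).1 hy]

theorem zproj_of_mem_ne {d e : ℤ} {y : R} (hy : y ∈ zpiece k 𝒜 e) (hne : e ≠ d) :
    zproj 𝒜 d y = 0 := by
  unfold zpiece at hy
  unfold zproj
  split_ifs at hy ⊢
  · rw [GradedRing.proj_apply, DirectSum.decompose_of_mem_ne 𝒜 hy (by omega)]
  · simp [(Submodule.mem_bot k).1 hy]
  · rfl
  · rfl

variable (𝒜) in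
theorem isGradedModule_self : IsGradedModule 𝒜 (fun d (r : R) => r ∈ zpiece k 𝒜 d) := by
  refine ⟨fun n e r y hr hy => ?_, ⟨zproj 𝒜, zproj_mem, fun _ _ => zproj_of_mem,
    fun _ _ _ => zproj_of_mem_ne⟩, fun y => ?_⟩
  · unfold zpiece at *
    split_ifs at hr with hn
    · split_ifs at hy with he
      · rw [if_pos (by omega), Int.toNat_add hn he]
        exact SetLike.mul_mem_graded hr hy
      · simp [(Submodule.mem_bot k).1 hy]
    · simp [(Submodule.mem_bot k).1 hr]
  · induction y using DirectSum.Decomposition.inductionOn 𝒜 with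
    | zero => exact zero_mem _
    | @homogeneous i m =>
      exact AddSubgroup.subset_closure ⟨(i : ℤ), by simp [zpiece]⟩
    | add m m' h h' => exact add_mem h h'

theorem isGradedModule_ideal {I : Ideal R} (hI : I.IsHomogeneous 𝒜) :
    IsGradedModule 𝒜 (fun d (x : I) => x ∈ idealGrading 𝒜 I d) := by
  have hmem : ∀ d, ∀ y ∈ I, zproj 𝒜 d y ∈ I := by
    intro d y hy
    unfold zproj
    split_ifs
    · exact hI _ hy
    · exact zero_mem _
  refine ⟨fun n e r y hr hy => (isGradedModule_self 𝒜).smul_mem n e r _ hr hy, ?_, fun y => ?_⟩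
  · refine ⟨fun d => AddMonoidHom.mk' (fun y : I => (⟨zproj 𝒜 d y, hmem d y y.2⟩ : I))
      fun a b => Subtype.ext (map_add _ _ _), fun d y => zproj_mem d y.1,
      fun d y hy => Subtype.ext (zproj_of_mem hy),
      fun d e y hy hne => Subtype.ext (zproj_of_mem_ne hy hne)⟩
  · classical
    have hy : y = ∑ i ∈ (DirectSum.decompose 𝒜 (y : R)).support,
        (⟨DirectSum.decompose 𝒜 (y : R) i, hI i y.2⟩ : I) := by
      refine Subtype.ext ?_
      rw [AddSubmonoidClass.coe_finsetSum]
      exact (DirectSum.sum_support_decompose 𝒜 (y : R)).symm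
    rw [hy]
    refine sum_mem fun i _ => AddSubgroup.subset_closure ⟨(i : ℤ), ?_⟩
    simp [idealGrading, zpiece]

variable (𝒜) in
theorem isGradedModule_freeMod (β : ℕ → ℤ → ℕ) (i : ℕ) :
    IsGradedModule 𝒜 (IsHomogEl k 𝒜 β i) := by
  have G := isGradedModule_self 𝒜
  refine ⟨fun n e r y hr hy p => ?_, ?_, fun y => ?_⟩
  · have := G.smul_mem n _ r _ hr (hy p)
    rwa [← add_sub_assoc] at this
  · obtain ⟨π, h1, h2, h3⟩ := G.exists_proj
    let ρ : ℤ → FreeMod R β i →+ FreeMod R β i := fun d =>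
      Finsupp.liftAddHom fun p => (Finsupp.singleAddHom p).comp (π (d - p.1))
    have hρ : ∀ d x p, ρ d x p = π (d - p.1) (x p) := by
      classical
      intro d x p
      induction x using Finsupp.induction_linear with
      | zero => simp
      | add f g hf hg => simp [hf, hg]
      | single a b =>
        simp only [ρ, Finsupp.liftAddHom_apply_single, AddMonoidHom.comp_apply,
          Finsupp.singleAddHom_apply, Finsupp.single_apply]
        split_ifs with h
        · rw [h]
        · simp
    refine ⟨ρ, fun d y p => ?_, fun d y hy => ?_, fun d e y hy hne => ?_⟩
    · rw [hρ]; exact h1 _ _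
    · ext p; rw [hρ]; exact h2 _ _ (hy p)
    · ext p; rw [hρ]; exact h3 _ _ _ (hy p) (by omega)
  · induction y using Finsupp.induction_linear with
    | zero => exact zero_mem _
    | add f g hf hg => exact add_mem hf hg
    | single p r =>
      have := G.mem_closure r
      induction this using AddSubgroup.closure_induction with
      | mem x hx =>
        classical
        obtain ⟨e, he⟩ := hx
        refine AddSubgroup.subset_closure ⟨e + p.1, fun q => ?_⟩
        rw [Finsupp.single_apply]
        split_ifs with h
        · subst h; simpa using he
        · exact zero_mem _
      | zero => simp
      | add x y _ _ hx hy => rw [Finsupp.single_add]; exact add_mem hx hy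
      | neg x _ hx => rw [Finsupp.single_neg]; exact neg_mem hx

variable (𝒜) in
theorem isHomogEl_single_one (β : ℕ → ℤ → ℕ) (i : ℕ) (p : (j : ℤ) × Fin (β i j)) :
    IsHomogEl k 𝒜 β i p.1 (Finsupp.single p 1) := by
  classical
  intro q
  rw [Finsupp.single_apply]
  split_ifs with h
  · subst h; simpa [zpiece] using SetLike.one_mem_graded 𝒜
  · exact zero_mem _

variable (𝒜) in
theorem isGradedProjective_freeMod (β : ℕ → ℤ → ℕ) (i : ℕ) :
    IsGradedProjective 𝒜 (IsHomogEl k 𝒜 β i) := by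
  intro Y Z _ _ _ _ hY hZ g w GY GZ hg hw hr
  have hex : ∀ p : (j : ℤ) × Fin (β i j), ∃ y, hY p.1 y ∧ g y = w (Finsupp.single p 1) := by
    intro p
    obtain ⟨y, hy⟩ := hr (Finsupp.single p 1)
    rw [← hy]
    apply GY.exists_homog_preimage GZ hg
    rw [hy]
    exact hw _ _ (isHomogEl_single_one 𝒜 β i p)
  choose y hy hgy using hex
  refine ⟨Finsupp.linearCombination R y, fun d x hx => ?_, fun s => ?_⟩
  · rw [Finsupp.linearCombination_apply, Finsupp.sum]
    refine GY.sum _ _ fun p _ => ?_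
    simpa using GY.smul_mem _ _ _ _ (hx p) (hy p)
  · have : g ∘ₗ Finsupp.linearCombination R y = w := by
      ext p; simp [hgy]
    exact LinearMap.congr_fun this s

end

section

variable (𝒜) in
/-- A resolution of a graded module by graded projective modules. -/
structure GradedProjectiveResolution {T : ℕ → Type} [∀ i, AddCommGroup (T i)]
    [∀ i, Module R (T i)] (hT : ∀ i, ℤ → T i → Prop) {N : Type} [AddCommGroup N] [Module R N]
    (hN : ℤ → N → Prop) where
  d : ∀ i, T (i + 1) →ₗ[R] T i
  eps : T 0 →ₗ[R] N
  eps_surj : ∀ n, ∃ x, eps x = n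
  eps_d : ∀ x, eps (d 0 x) = 0
  d_d : ∀ i x, d i (d (i + 1) x) = 0
  exact_zero : ∀ x, eps x = 0 → ∃ y, d 0 y = x
  exact_succ : ∀ i x, d i x = 0 → ∃ y, d (i + 1) y = x
  isGraded : ∀ i, IsGradedModule 𝒜 (hT i)
  isGraded_target : IsGradedModule 𝒜 hN
  isProjective : ∀ i, IsGradedProjective 𝒜 (hT i)
  graded_d : ∀ i, IsDegreePreserving (hT (i + 1)) (hT i) (d i)
  graded_eps : IsDegreePreserving (hT 0) hN eps

/-- Dependent recursion for sequences whose consecutive terms satisfy a relation. -/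
theorem exists_seq_of_step {α : ℕ → Type} (Q : ∀ i, α i → Prop) (P : ∀ i, α i → α (i + 1) → Prop)
    (base : ∃ a, Q 0 a) (step : ∀ i a, Q i a → ∃ b, Q (i + 1) b ∧ P i a b) :
    ∃ f : ∀ i, α i, ∀ i, Q i (f i) ∧ P i (f i) (f (i + 1)) := by
  choose next h1 h2 using step
  obtain ⟨a, ha⟩ := base
  let f : ∀ i, {a : α i // Q i a} := fun i =>
    Nat.rec ⟨a, ha⟩ (fun i b => ⟨next i b.1 b.2, h1 i b.1 b.2⟩) i
  exact ⟨fun i => (f i).1, fun i => ⟨(f i).2, h2 i _ (f i).2⟩⟩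

variable {S T : ℕ → Type} [∀ i, AddCommGroup (S i)] [∀ i, Module R (S i)]
  [∀ i, AddCommGroup (T i)] [∀ i, Module R (T i)]
  {hS : ∀ i, ℤ → S i → Prop} {hT : ∀ i, ℤ → T i → Prop}
  {M N : Type} [AddCommGroup M] [Module R M] [AddCommGroup N] [Module R N]
  {hM : ℤ → M → Prop} {hN : ℤ → N → Prop}

/-- A degree-preserving map lifts to a degree-preserving map of resolutions. -/
theorem GradedProjectiveResolution.exists_lift (A : GradedProjectiveResolution 𝒜 hS hM)
    (B : GradedProjectiveResolution 𝒜 hT hN) (u : M →ₗ[R] N) (hu : IsDegreePreserving hM hN u) :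
    ∃ φ : ∀ i, S i →ₗ[R] T i, (∀ i, IsDegreePreserving (hS i) (hT i) (φ i)) ∧
      (∀ x, B.eps (φ 0 x) = u (A.eps x)) ∧ ∀ i x, B.d i (φ (i + 1) x) = φ i (A.d i x) := by
  obtain ⟨φ₀, h1, h2⟩ := A.isProjective 0 _ _ (hT 0) hN B.eps (u ∘ₗ A.eps) (B.isGraded 0)
    B.isGraded_target B.graded_eps (fun d y hy => hu _ _ (A.graded_eps _ _ hy))
    (fun s => B.eps_surj _)
  obtain ⟨φ, hφ⟩ := exists_seq_of_step (α := fun i => S i →ₗ[R] T i)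
    (fun i f => IsDegreePreserving (hS i) (hT i) f ∧ (∀ x, ∃ y, B.d i y = f (A.d i x)) ∧
      ∀ h : i = 0, f = h ▸ φ₀)
    (fun i f g => ∀ x, B.d i (g x) = f (A.d i x))
    ⟨φ₀, h1, fun x => B.exact_zero _ (by rw [h2]; simp [A.eps_d]), fun _ => rfl⟩ (by
      rintro i f ⟨hf, hr, -⟩
      obtain ⟨g, hg, hg'⟩ := A.isProjective (i + 1) _ _ (hT (i + 1)) (hT i) (B.d i) (f ∘ₗ A.d i)
        (B.isGraded _) (B.isGraded _) (B.graded_d i) (fun d y hy => hf _ _ (A.graded_d _ _ _ hy)) hr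
      exact ⟨g, ⟨hg, fun x => B.exact_succ _ _ (by rw [hg']; simp [A.d_d]),
        fun h => absurd h (by omega)⟩, hg'⟩)
  refine ⟨φ, fun i => (hφ i).1.1, fun x => ?_, fun i => (hφ i).2⟩
  rw [(hφ 0).1.2.2 rfl]
  exact h2 x

theorem map_mem_ideal_smul_top {X Y : Type} [AddCommGroup X] [Module R X] [AddCommGroup Y]
    [Module R Y] {m : Ideal R} (f : X →ₗ[R] Y) {x : X} (hx : x ∈ m • (⊤ : Submodule R X)) :
    f x ∈ m • (⊤ : Submodule R Y) := by
  have := Submodule.mem_map_of_mem (f := f) hx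
  rw [Submodule.map_smul''] at this
  exact Submodule.smul_mono le_rfl le_top this

/-- On a minimal resolution, every endomorphism lifting the identity is the identity modulo the
ideal `m`. -/
theorem GradedProjectiveResolution.sub_mem_of_minimal (A : GradedProjectiveResolution 𝒜 hS hM)
    (m : Ideal R) (heps : ∀ x, A.eps x = 0 → x ∈ m • (⊤ : Submodule R (S 0)))
    (hd : ∀ i x, A.d i x ∈ m • (⊤ : Submodule R (S i)))
    (g : ∀ i, S i →ₗ[R] S i) (hg : ∀ i, IsDegreePreserving (hS i) (hS i) (g i))
    (hg0 : ∀ x, A.eps (g 0 x) = A.eps x) (hgd : ∀ i x, A.d i (g (i + 1) x) = g i (A.d i x))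
    (i : ℕ) (x : S i) : g i x - x ∈ m • (⊤ : Submodule R (S i)) := by
  have key : ∀ i, (∃ h : S i →ₗ[R] S (i + 1), IsDegreePreserving (hS i) (hS (i + 1)) h ∧
      ∀ x, g i (A.d i x) - A.d i x - A.d i (h (A.d i x)) = 0) ∧
      ∀ x, g i x - x ∈ m • (⊤ : Submodule R (S i)) := by
    intro i
    induction i with
    | zero =>
      refine ⟨?_, fun x => heps _ (by simp [hg0])⟩
      obtain ⟨h, hh, hh'⟩ := A.isProjective 0 _ _ (hS 1) (hS 0) (A.d 0) (g 0 - LinearMap.id)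
        (A.isGraded _) (A.isGraded _) (A.graded_d 0)
        (fun d y hy => by
          simpa [sub_eq_add_neg] using (A.isGraded 0).add (hg 0 _ _ hy) ((A.isGraded 0).neg hy))
        (fun s => A.exact_zero _ (by simp [hg0]))
      exact ⟨h, hh, fun x => by rw [hh']; simp⟩
    | succ i ih =>
      obtain ⟨⟨h, hh, hh'⟩, -⟩ := ih
      obtain ⟨h2, hh2, hh2'⟩ := A.isProjective (i + 1) _ _ (hS (i + 2)) (hS (i + 1)) (A.d (i + 1))
        (g (i + 1) - LinearMap.id - h ∘ₗ A.d i)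
        (A.isGraded _) (A.isGraded _) (A.graded_d _)
        (fun d y hy => by
          simpa [sub_eq_add_neg] using (A.isGraded _).add
            ((A.isGraded _).add (hg _ _ _ hy) ((A.isGraded _).neg hy))
            ((A.isGraded _).neg (hh _ _ (A.graded_d _ _ _ hy))))
        (fun s => A.exact_succ _ _ (by simpa [hgd] using hh' s))
      refine ⟨⟨h2, hh2, fun x => by rw [hh2']; simp [A.d_d]⟩, fun x => ?_⟩
      have e : g (i + 1) x - x = A.d (i + 1) (h2 x) + h (A.d i x) := by
        rw [hh2']; simp
      rw [e]
      exact add_mem (hd _ _) (map_mem_ideal_smul_top _ (hd _ _))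
  exact (key i).2 x

end

section Cone

variable {S T : ℕ → Type} [∀ i, AddCommGroup (S i)] [∀ i, Module R (S i)]
  [∀ i, AddCommGroup (T i)] [∀ i, Module R (T i)]
  {hS : ∀ i, ℤ → S i → Prop} {hT : ∀ i, ℤ → T i → Prop}

/-- The Betti table shifted by one in homological degree. -/
abbrev bettiShift (β : ℕ → ℤ → ℕ) : ℕ → ℤ → ℕ
  | 0 => fun _ => 0
  | i + 1 => β i

/-- The mapping cone of the lift of `I ∩ J → I ⊕ J` resolves `I + J`. -/
theorem nonempty_gradedProjectiveResolution_sup [GradedAlgebra 𝒜] {I J P : Ideal R}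
    (hP : P = I + J) (hPhom : P.IsHomogeneous 𝒜) {β : ℕ → ℤ → ℕ}
    (A : GradedProjectiveResolution 𝒜 hS (fun d (x : I) => x ∈ idealGrading 𝒜 I d))
    (B : GradedProjectiveResolution 𝒜 hT (fun d (x : J) => x ∈ idealGrading 𝒜 J d))
    (C : GradedProjectiveResolution 𝒜 (IsHomogEl k 𝒜 β)
      (fun d (x : (I ⊓ J : Ideal R)) => x ∈ idealGrading 𝒜 (I ⊓ J) d)) :
    Nonempty (GradedProjectiveResolution 𝒜
      (T := fun i => S i × T i × FreeMod R (bettiShift β) i)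
      (fun i => prodHomog (hS i) (prodHomog (hT i) (IsHomogEl k 𝒜 (bettiShift β) i)))
      (fun d (x : P) => x ∈ idealGrading 𝒜 P d)) := by
  have hIP : I ≤ P := hP ▸ le_sup_left
  have hJP : J ≤ P := hP ▸ le_sup_right
  obtain ⟨f, hf, hf0, hfd⟩ := C.exists_lift A (Submodule.inclusion inf_le_left) (fun d y hy => hy)
  obtain ⟨f', hf', hf0', hfd'⟩ := C.exists_lift B (-Submodule.inclusion inf_le_right)
    (fun d y hy => neg_mem (S := Submodule k J) hy)
  let δ : ∀ i, FreeMod R (bettiShift β) (i + 1) →ₗ[R] FreeMod R (bettiShift β) i := fun i =>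
    match i with
    | 0 => 0
    | i + 1 => C.d i
  let F : ∀ i, FreeMod R (bettiShift β) (i + 1) →ₗ[R] S i := f
  let F' : ∀ i, FreeMod R (bettiShift β) (i + 1) →ₗ[R] T i := f'
  let D : ∀ i, (S (i + 1) × T (i + 1) × FreeMod R (bettiShift β) (i + 1)) →ₗ[R]
      (S i × T i × FreeMod R (bettiShift β) i) := fun i =>
    (((A.d i).coprod 0) + F i ∘ₗ LinearMap.snd _ _ _ ∘ₗ LinearMap.snd _ _ _).prod
      (((B.d i) ∘ₗ LinearMap.fst _ _ _ ∘ₗ LinearMap.snd _ _ _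
        + F' i ∘ₗ LinearMap.snd _ _ _ ∘ₗ LinearMap.snd _ _ _).prod
        (-(δ i ∘ₗ LinearMap.snd _ _ _ ∘ₗ LinearMap.snd _ _ _)))
  have hD : ∀ i a b c, D i (a, b, c) = (A.d i a + F i c, B.d i b + F' i c, -δ i c) := by
    intro i a b c; simp [D]
  let E : (S 0 × T 0 × FreeMod R (bettiShift β) 0) →ₗ[R] P :=
    (Submodule.inclusion hIP ∘ₗ A.eps).coprod
      ((Submodule.inclusion hJP ∘ₗ B.eps) ∘ₗ LinearMap.fst _ _ _)
  have hE : ∀ a b c, ((E (a, b, c) : P) : R) = (A.eps a : R) + (B.eps b : R) := by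
    intro a b c; simp [E]
  have hFe : ∀ c, (A.eps (F 0 c) : R) = (C.eps c : R) := fun c => by
    simp only [F]; rw [hf0]; rfl
  have hFe' : ∀ c, (B.eps (F' 0 c) : R) = -(C.eps c : R) := fun c => by
    simp only [F']; rw [hf0']; rfl
  have hδδ : ∀ i c, δ i (δ (i + 1) c) = 0 := by
    intro i c
    cases i with
    | zero => rfl
    | succ i => exact C.d_d i c
  have hFδ : ∀ i c, A.d i (F (i + 1) c) = F i (δ (i + 1) c) := fun i c => hfd i c
  have hFδ' : ∀ i c, B.d i (F' (i + 1) c) = F' i (δ (i + 1) c) := fun i c => hfd' i c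
  have hsub : ∀ c c' : FreeMod R (bettiShift β) 0, c = c' := fun c c' => by
    ext p; exact p.2.elim0
  refine ⟨⟨D, E, ?_, ?_, ?_, ?_, ?_, ?_, isGradedModule_ideal hPhom, ?_, ?_, ?_⟩⟩
  · rintro ⟨n, hn⟩
    have hn' := hn
    rw [hP] at hn'
    obtain ⟨a, ha, b, hb, hab⟩ := Submodule.mem_sup.1 hn'
    obtain ⟨x, hx⟩ := A.eps_surj ⟨a, ha⟩
    obtain ⟨y, hy⟩ := B.eps_surj ⟨b, hb⟩
    refine ⟨(x, y, 0), Subtype.ext ?_⟩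
    rw [hE, hx, hy, hab]
  · rintro ⟨a, b, c⟩
    refine Subtype.ext ?_
    rw [hD, hE, map_add, map_add, A.eps_d, B.eps_d]
    simp only [Submodule.coe_add, hFe, hFe']
    simp
  · rintro i ⟨a, b, c⟩
    rw [hD, hD]
    simp [A.d_d, B.d_d, hFδ, hFδ', hδδ]
  · rintro ⟨a, b, c⟩ h
    have h' : (A.eps a : R) + (B.eps b : R) = 0 := by rw [← hE a b c, h]; rfl
    have hmem : (A.eps a : R) ∈ I ⊓ J :=
      ⟨(A.eps a).2, by rw [eq_neg_of_add_eq_zero_left h']; exact neg_mem (B.eps b).2⟩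
    obtain ⟨z, hz⟩ := C.eps_surj ⟨_, hmem⟩
    obtain ⟨x, hx⟩ := A.exact_zero (a - F 0 z) (Subtype.ext (by simp [hFe, hz]))
    obtain ⟨y, hy⟩ := B.exact_zero (b - F' 0 z) (Subtype.ext (by
      simp [hFe', hz]; rw [add_comm]; exact h'))
    refine ⟨(x, y, z), ?_⟩
    rw [hD, hx, hy, sub_add_cancel, sub_add_cancel]
    exact Prod.ext rfl (Prod.ext rfl (hsub _ _))
  · rintro i ⟨a, b, c⟩ h
    rw [hD] at h
    simp only [Prod.mk_eq_zero, neg_eq_zero] at h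
    obtain ⟨h1, h2, h3⟩ := h
    have hz : ∃ z, -δ (i + 1) z = c := by
      cases i with
      | zero =>
        obtain ⟨z, hz⟩ := C.exact_zero c (Subtype.ext (by
          have := hFe c
          rw [eq_neg_of_add_eq_zero_right h1, map_neg, A.eps_d] at this
          simpa using this.symm))
        exact ⟨-z, by rw [map_neg, neg_neg]; exact hz⟩
      | succ i =>
        obtain ⟨z, hz⟩ := C.exact_succ i c h3
        exact ⟨-z, by rw [map_neg, neg_neg]; exact hz⟩
    obtain ⟨z, hz⟩ := hz
    obtain ⟨x, hx⟩ := A.exact_succ i (a - F (i + 1) z) (by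
      rw [map_sub, hFδ, ← h1, ← hz, map_neg, sub_eq_add_neg])
    obtain ⟨y, hy⟩ := B.exact_succ i (b - F' (i + 1) z) (by
      rw [map_sub, hFδ', ← h2, ← hz, map_neg, sub_eq_add_neg])
    refine ⟨(x, y, z), ?_⟩
    rw [hD, hx, hy, sub_add_cancel, sub_add_cancel, hz]
  · exact fun i => (A.isGraded i).prod ((B.isGraded i).prod (isGradedModule_freeMod 𝒜 _ i))
  · exact fun i => (A.isProjective i).prod (A.isGraded i)
      ((B.isGraded i).prod (isGradedModule_freeMod 𝒜 _ i))
      ((B.isProjective i).prod (B.isGraded i) (isGradedModule_freeMod 𝒜 _ i)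
        (isGradedProjective_freeMod 𝒜 _ i))
  · rintro i d ⟨a, b, c⟩ ⟨ha, hb, hc⟩
    rw [hD]
    refine ⟨(A.isGraded i).add (A.graded_d _ _ _ ha) (hf i d c hc),
      (B.isGraded i).add (B.graded_d _ _ _ hb) (hf' i d c hc),
      (isGradedModule_freeMod 𝒜 _ i).neg ?_⟩
    cases i with
    | zero => exact (isGradedModule_freeMod 𝒜 _ 0).zero d
    | succ i => exact C.graded_d i d c hc
  · rintro d ⟨a, b, c⟩ ⟨ha, hb, hc⟩
    change ((E (a, b, c) : P) : R) ∈ zpiece k 𝒜 d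
    rw [hE]
    exact add_mem (A.graded_eps d a ha) (B.graded_eps d b hb)

end Cone

section BettiNumbers

theorem zpiece_le_gradedMax {d : ℤ} (hd : d ≠ 0) {r : R} (hr : r ∈ zpiece k 𝒜 d) :
    r ∈ gradedMax k 𝒜 := by
  unfold zpiece at hr
  split_ifs at hr with h
  · refine Ideal.subset_span (Set.mem_iUnion.2 ⟨d.toNat - 1, ?_⟩)
    rwa [show d.toNat - 1 + 1 = d.toNat by omega]
  · rw [(Submodule.mem_bot k).1 hr]
    exact zero_mem _

variable [GradedAlgebra 𝒜]

/-- A minimal graded free resolution of a graded module is a graded projective resolution. -/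
def MinimalGradedFreeResolution.toGradedProjectiveResolution {β : ℕ → ℤ → ℕ} {M : Type}
    [AddCommGroup M] [Module R M] [Module k M] {ℳ : ℤ → Submodule k M}
    (F : MinimalGradedFreeResolution k 𝒜 β M ℳ) (hM : IsGradedModule 𝒜 (fun d x => x ∈ ℳ d)) :
    GradedProjectiveResolution 𝒜 (IsHomogEl k 𝒜 β) (fun d x => x ∈ ℳ d) where
  d := F.dd
  eps := F.eps
  eps_surj := F.eps_surj
  eps_d _ := F.exact_zero.ge ⟨_, rfl⟩
  d_d i _ := (F.exact_succ i).ge ⟨_, rfl⟩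
  exact_zero _ hx := F.exact_zero.le hx
  exact_succ i _ hx := (F.exact_succ i).le hx
  isGraded := isGradedModule_freeMod 𝒜 β
  isGraded_target := hM
  isProjective := isGradedProjective_freeMod 𝒜 β
  graded_d i d x hx := F.graded_d i d x hx
  graded_eps d x hx := F.graded_eps d x hx

variable (𝒜) in
theorem gradedMax_ne_top [Nontrivial R] : gradedMax k 𝒜 ≠ ⊤ := by
  intro h
  have hle : gradedMax k 𝒜 ≤ RingHom.ker (GradedRing.projZeroRingHom 𝒜) := by
    refine Ideal.span_le.2 fun x hx => ?_
    obtain ⟨n, hn⟩ := Set.mem_iUnion.1 hx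
    change (DirectSum.decompose 𝒜 x 0 : R) = 0
    exact DirectSum.decompose_of_mem_ne 𝒜 hn (by omega)
  have h1 : (1 : R) ∈ RingHom.ker (GradedRing.projZeroRingHom 𝒜) := hle (h ▸ Submodule.mem_top)
  rw [RingHom.mem_ker, map_one] at h1
  exact one_ne_zero h1

theorem Finsupp.mem_ideal_smul_top_iff {σ : Type} (𝔞 : Ideal R) (x : σ →₀ R) :
    x ∈ 𝔞 • (⊤ : Submodule R (σ →₀ R)) ↔ ∀ p, x p ∈ 𝔞 := by
  constructor
  · intro h p
    induction h using Submodule.smul_induction_on' with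
    | smul r hr n hn => exact 𝔞.mul_mem_right _ hr
    | add x _ y _ hx hy => exact add_mem hx hy
  · intro h
    rw [← Finsupp.sum_single x]
    refine sum_mem fun p _ => ?_
    rw [← mul_one (x p), ← smul_eq_mul, ← Finsupp.smul_single]
    exact Submodule.smul_mem_smul (h p) Submodule.mem_top

/-- A matrix over `R` that is injective modulo a maximal ideal has at least as many rows as
columns. -/
theorem card_le_card_of_injective_mod {m n : Type} [Fintype m] [Fintype n] (𝔐 : Ideal R)
    [𝔐.IsMaximal] (A : m → n → R)
    (h : ∀ v : n → R, (∀ q, ∑ p, v p * A q p ∈ 𝔐) → ∀ p, v p ∈ 𝔐) :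
    Fintype.card n ≤ Fintype.card m := by
  classical
  let _ := Ideal.Quotient.field 𝔐
  let f : (n → R ⧸ 𝔐) →ₗ[R ⧸ 𝔐] (m → R ⧸ 𝔐) :=
    Matrix.mulVecLin (Matrix.of fun q p => Ideal.Quotient.mk 𝔐 (A q p))
  have hf : Function.Injective f := by
    rw [← LinearMap.ker_eq_bot, LinearMap.ker_eq_bot']
    intro w hw
    choose v hv using fun p => Ideal.Quotient.mk_surjective (w p)
    have := h v fun q => by
      rw [← Ideal.Quotient.eq_zero_iff_mem, map_sum]
      simpa [f, Matrix.mulVec, dotProduct, ← hv, mul_comm] using congrFun hw q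
    funext p
    rw [← hv p]
    exact Ideal.Quotient.eq_zero_iff_mem.2 (this p)
  simpa using LinearMap.finrank_le_finrank_of_injective hf

/-- The graded Betti numbers of `I + J` are bounded by those of the mapping cone. -/
theorem betti_sup_le {I J P : Ideal R} (hP : P = I + J) (hI0 : I ≠ ⊥)
    (hI : I.IsHomogeneous 𝒜) (hJ : J.IsHomogeneous 𝒜) {βI βJ βIJ βP : ℕ → ℤ → ℕ}
    (FI : MinimalGradedFreeResolution k 𝒜 βI ↥I (idealGrading 𝒜 I))
    (FJ : MinimalGradedFreeResolution k 𝒜 βJ ↥J (idealGrading 𝒜 J))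
    (FIJ : MinimalGradedFreeResolution k 𝒜 βIJ ↥(I ⊓ J) (idealGrading 𝒜 (I ⊓ J)))
    (FP : MinimalGradedFreeResolution k 𝒜 βP ↥P (idealGrading 𝒜 P)) (i : ℕ) (j : ℤ) :
    βP i j ≤ βI i j + βJ i j + bettiShift βIJ i j := by
  classical
  have hPhom : P.IsHomogeneous 𝒜 := hP ▸ hI.sup hJ
  obtain ⟨C⟩ := nonempty_gradedProjectiveResolution_sup hP hPhom
    (FI.toGradedProjectiveResolution (isGradedModule_ideal hI))
    (FJ.toGradedProjectiveResolution (isGradedModule_ideal hJ))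
    (FIJ.toGradedProjectiveResolution (isGradedModule_ideal (hI.inf hJ)))
  let G := FP.toGradedProjectiveResolution (isGradedModule_ideal hPhom)
  obtain ⟨φ, hφ, hφ0, hφd⟩ := G.exists_lift C LinearMap.id fun _ _ h => h
  obtain ⟨ψ, hψ, hψ0, hψd⟩ := C.exists_lift G LinearMap.id fun _ _ h => h
  have hmin : ∀ x, ψ i (φ i x) - x ∈ gradedMax k 𝒜 • (⊤ : Submodule R (FreeMod R βP i)) :=
    G.sub_mem_of_minimal (gradedMax k 𝒜) (fun x hx => FP.min_eps hx)
      (fun i x => FP.min_d i ⟨x, rfl⟩) (fun i => ψ i ∘ₗ φ i)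
      (fun i d x hx => hψ i d _ (hφ i d x hx)) (fun x => by simp [hψ0, hφ0])
      (fun i x => by simp [hψd, hφd]) i
  have : Nontrivial R := by
    by_contra h
    rw [not_nontrivial_iff_subsingleton] at h
    exact hI0 (Subsingleton.elim _ _)
  obtain ⟨𝔐, h𝔐, hle⟩ := Ideal.exists_le_maximal _ (gradedMax_ne_top 𝒜)
  let e : Fin (βP i j) → FreeMod R βP i := fun p => Finsupp.single ⟨j, p⟩ 1
  have he : ∀ p, prodHomog (IsHomogEl k 𝒜 βI i) (prodHomog (IsHomogEl k 𝒜 βJ i)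
      (IsHomogEl k 𝒜 (bettiShift βIJ) i)) j (φ i (e p)) := fun p =>
    hφ i j _ (isHomogEl_single_one 𝒜 βP i ⟨j, p⟩)
  have off : ∀ {β : ℕ → ℤ → ℕ} (x : FreeMod R β i) (q : (l : ℤ) × Fin (β i l)),
      IsHomogEl k 𝒜 β i j x → q.1 ≠ j → x q ∈ 𝔐 := fun x q hx hq =>
    hle (zpiece_le_gradedMax (by omega) (hx q))
  let A : (Fin (βI i j) ⊕ Fin (βJ i j)) ⊕ Fin (bettiShift βIJ i j) → Fin (βP i j) → R :=
    fun q p => Sum.elim (Sum.elim (fun q => (φ i (e p)).1 ⟨j, q⟩)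
      (fun q => (φ i (e p)).2.1 ⟨j, q⟩)) (fun q => (φ i (e p)).2.2 ⟨j, q⟩) q
  have := card_le_card_of_injective_mod 𝔐 A fun v hv => ?_
  · simpa using this
  set x : FreeMod R βP i := ∑ p, v p • e p with hx
  have comp : ∀ {β : ℕ → ℤ → ℕ} (f : (FreeMod R βI i × FreeMod R βJ i ×
      FreeMod R (bettiShift βIJ) i) →ₗ[R] FreeMod R β i),
      (∀ p, IsHomogEl k 𝒜 β i j (f (φ i (e p)))) →
      (∀ q, ∑ p, v p * f (φ i (e p)) ⟨j, q⟩ ∈ 𝔐) →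
      f (φ i x) ∈ 𝔐 • (⊤ : Submodule R (FreeMod R β i)) := by
    intro β f h1 h2
    rw [Finsupp.mem_ideal_smul_top_iff]
    rintro ⟨l, q⟩
    have : f (φ i x) ⟨l, q⟩ = ∑ p, v p * f (φ i (e p)) ⟨l, q⟩ := by
      simp [hx, map_sum, Finsupp.finsetSum_apply]
    rw [this]
    by_cases hl : l = j
    · subst hl; exact h2 q
    · exact sum_mem fun p _ => 𝔐.mul_mem_left _ (off _ _ (h1 p) hl)
  have c1 := comp (LinearMap.fst _ _ _) (fun p => (he p).1) (fun q => hv (Sum.inl (Sum.inl q)))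
  have c2 := comp (LinearMap.fst _ _ _ ∘ₗ LinearMap.snd _ _ _) (fun p => (he p).2.1)
    (fun q => hv (Sum.inl (Sum.inr q)))
  have c3 := comp (LinearMap.snd _ _ _ ∘ₗ LinearMap.snd _ _ _) (fun p => (he p).2.2)
    (fun q => hv (Sum.inr q))
  have hφx : φ i x ∈ 𝔐 • (⊤ : Submodule R (FreeMod R βI i × FreeMod R βJ i ×
      FreeMod R (bettiShift βIJ) i)) := by
    have h1 := map_mem_ideal_smul_top
      (LinearMap.inl R _ (FreeMod R βJ i × FreeMod R (bettiShift βIJ) i)) c1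
    have h2 := map_mem_ideal_smul_top (LinearMap.inr R (FreeMod R βI i) _ ∘ₗ
      LinearMap.inl R _ (FreeMod R (bettiShift βIJ) i)) c2
    have h3 := map_mem_ideal_smul_top (LinearMap.inr R (FreeMod R βI i) _ ∘ₗ
      LinearMap.inr R (FreeMod R βJ i) _) c3
    simpa using add_mem h1 (add_mem h2 h3)
  have hx𝔐 : x ∈ 𝔐 • (⊤ : Submodule R (FreeMod R βP i)) := by
    simpa using sub_mem (map_mem_ideal_smul_top (ψ i) hφx) (Submodule.smul_mono hle le_rfl (hmin x))
  intro p
  have := (Finsupp.mem_ideal_smul_top_iff 𝔐 x).1 hx𝔐 ⟨j, p⟩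
  simpa [hx, e, Finsupp.finsetSum_apply, Finsupp.single_apply] using this

end BettiNumbers

end GradedModules

theorem totalBetti_eq_sum {β : ℕ → ℤ → ℕ} {i : ℕ} {s : Finset ℤ}
    (hs : ∀ j, β i j ≠ 0 → j ∈ s) : totalBetti β i = ∑ j ∈ s, β i j :=
  finsum_eq_sum_of_support_subset _ fun j hj => hs j hj

theorem regOfSub1_eq_regOf_bettiShift (β : ℕ → ℤ → ℕ) :
    regOfSub1 β = regOf (bettiShift β) := by
  unfold regOfSub1 regOf
  congr 1
  ext x
  constructor
  · rintro ⟨i, j, h, rfl⟩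
    exact ⟨i + 1, j, h, by rw [show j - i - 1 = j - (i + 1 : ℕ) by push_cast; ring]⟩
  · rintro ⟨i, j, h, rfl⟩
    cases i with
    | zero => exact absurd rfl h
    | succ i => exact ⟨i, j, h, by rw [show j - i - 1 = j - (i + 1 : ℕ) by push_cast; ring]⟩

theorem regOf_eq_max_of_eq_add {β β₁ β₂ β₃ : ℕ → ℤ → ℕ}
    (h : ∀ i j, β i j = β₁ i j + β₂ i j + β₃ i j) :
    regOf β = max (max (regOf β₁) (regOf β₂)) (regOf β₃) := by
  unfold regOf
  rw [← sSup_union, ← sSup_union]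
  congr 1
  ext x
  simp only [Set.mem_union, Set.mem_ofPred_eq, ← exists_or, ← or_and_right]
  refine exists_congr fun i => exists_congr fun j => and_congr_left fun _ => ?_
  rw [h]
  omega

/-- Let `R` be a standard graded algebra over a field `k`, and `P = I + J` a decomposition of
a homogeneous ideal with `I, J` non-zero homogeneous ideals.  If the decomposition is a Betti
splitting, i.e. `β_i(P) = β_i(I) + β_i(J) + β_{i-1}(I ∩ J)` for all `i`, then
`reg_R P = max (reg_R I, reg_R J, reg_R (I ∩ J) - 1)`, where the Betti numbers and the
regularity are read off from (arbitrary) minimal graded free resolutions. -/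
theorem reg_of_betti_splitting
    {k : Type} [Field k] {R : Type} [CommRing R] [Algebra k R]
    (𝒜 : ℕ → Submodule k R) [GradedAlgebra 𝒜]
    (hstd : ∀ n, 𝒜 (n + 1) = 𝒜 1 * 𝒜 n) (hfin : Module.Finite k (𝒜 1))
    (I J P : Ideal R) (hP : P = I + J)
    (hI0 : I ≠ ⊥) (hJ0 : J ≠ ⊥)
    (hIhom : Ideal.IsHomogeneous 𝒜 I) (hJhom : Ideal.IsHomogeneous 𝒜 J)
    (βI βJ βIJ βP : ℕ → ℤ → ℕ)
    (FI : MinimalGradedFreeResolution k 𝒜 βI ↥I (idealGrading 𝒜 I))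
    (FJ : MinimalGradedFreeResolution k 𝒜 βJ ↥J (idealGrading 𝒜 J))
    (FIJ : MinimalGradedFreeResolution k 𝒜 βIJ ↥(I ⊓ J) (idealGrading 𝒜 (I ⊓ J)))
    (FP : MinimalGradedFreeResolution k 𝒜 βP ↥P (idealGrading 𝒜 P))
    (hsplit0 : totalBetti βP 0 = totalBetti βI 0 + totalBetti βJ 0)
    (hsplit : ∀ i : ℕ,
      totalBetti βP (i + 1) = totalBetti βI (i + 1) + totalBetti βJ (i + 1) + totalBetti βIJ i) :
    regOf βP = max (max (regOf βI) (regOf βJ)) (regOfSub1 βIJ) := by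
  rw [regOfSub1_eq_regOf_bettiShift]
  refine regOf_eq_max_of_eq_add fun i j => ?_
  have hle : ∀ j, βP i j ≤ βI i j + βJ i j + bettiShift βIJ i j :=
    betti_sup_le hP hI0 hIhom hJhom FI FJ FIJ FP i
  have hfinIJ : {j : ℤ | bettiShift βIJ i j ≠ 0}.Finite := by
    cases i with
    | zero => simp
    | succ i => exact FIJ.betti_finite i
  have htot : totalBetti βP i =
      totalBetti βI i + totalBetti βJ i + totalBetti (bettiShift βIJ) i := by
    cases i with
    | zero => simpa [totalBetti] using hsplit0
    | succ i => exact hsplit i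
  let s : Finset ℤ := insert j ((FP.betti_finite i).toFinset ∪ (FI.betti_finite i).toFinset ∪
    (FJ.betti_finite i).toFinset ∪ hfinIJ.toFinset)
  rw [totalBetti_eq_sum (s := s) fun l hl => by simp [s, hl],
    totalBetti_eq_sum (s := s) fun l hl => by simp [s, hl],
    totalBetti_eq_sum (s := s) fun l hl => by simp [s, hl],
    totalBetti_eq_sum (s := s) fun l hl => by simp only [s]; simp [hl],
    ← Finset.sum_add_distrib, ← Finset.sum_add_distrib] at htot
  exact (Finset.sum_eq_sum_iff_of_le fun l _ => hle l).1 htot j (by simp [s])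
end

section
/- Let $R$ and $S$ be polynomial rings over a field $k$ with graded maximal ideals $\mathfrak{m}$ and $\mathfrak{n}$, and let $I \subseteq \mathfrak{m}$, $J \subseteq \mathfrak{n}$ be non-zero proper monomial ideals. Set $T = R \otimes_k S$ and $P = I + J$. If both $I$ and $J$ have constant depth functions (i.e. $\operatorname{depth}(R/I^s)$ and $\operatorname{depth}(S/J^s)$ are constant in $s \ge 1$), then $P$ has a constant depth function, and $\operatorname{depth}(T/P^s) = \operatorname{depth}(R/I) + \operatorname{depth}(S/J)$ for all $s \ge 1$. -/
open MvPolynomial TensorProduct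

/-- An ideal of `k[x_1, …, x_m]` is a monomial ideal if it is generated by monomials. -/
def IsMonomialIdeal {m : ℕ} {k : Type} [Field k] (I : Ideal (MvPolynomial (Fin m) k)) : Prop :=
  ∃ S : Set (Fin m →₀ ℕ), I = Ideal.span ((fun e => monomial e (1 : k)) '' S)

/-- The depth of a module `M` over a ring `A` with respect to an ideal `mx` (for us: the
graded maximal ideal), defined as `inf {i | Ext^i_A(A/mx, M) ≠ 0} ∈ ℕ∞`. -/
noncomputable def depthOf (A : Type) [CommRing A] (mx : Ideal A)
    (M : Type) [AddCommGroup M] [Module A M] : ℕ∞ :=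
  sInf ((fun i : ℕ => (i : ℕ∞)) ''
    {i : ℕ | Nontrivial (((Ext A (ModuleCat A) i).obj
      (Opposite.op (ModuleCat.of A (A ⧸ mx)))).obj (ModuleCat.of A M))})

section Auxiliary

open CategoryTheory
open scoped Pointwise

set_option linter.unusedSectionVars false

section ExtVanishing

variable {A : Type} [CommRing A]

/-- `Ext^i_A(A/m, M) = 0`. -/
def ExtVanishes (m : Ideal A) (i : ℕ) (M : Type) [AddCommGroup M] [Module A M] : Prop :=
  Subsingleton (((Ext A (ModuleCat A) i).obj
    (Opposite.op (ModuleCat.of A (A ⧸ m)))).obj (ModuleCat.of A M))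

/-- Every `i`-cocycle of `Hom(P, Y)` is a coboundary. -/
def CocyclesBound {X : ModuleCat.{0} A} (P : ProjectiveResolution X) (i : ℕ)
    (Y : ModuleCat.{0} A) : Prop :=
  ∀ φ : P.complex.X i ⟶ Y, P.complex.d (i + 1) i ≫ φ = 0 →
    ∃ (j : ℕ) (ψ : P.complex.X j ⟶ Y), P.complex.d i j ≫ ψ = φ

lemma subsingleton_Ext_iff {X : ModuleCat.{0} A} (P : ProjectiveResolution X) (i : ℕ)
    (Y : ModuleCat.{0} A) :
    Subsingleton (((Ext A (ModuleCat A) i).obj (Opposite.op X)).obj Y) ↔ CocyclesBound P i Y := by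
  rw [← ModuleCat.isZero_iff_subsingleton, (P.isoExt i Y).isZero_iff,
    ← HomologicalComplex.exactAt_iff_isZero_homology, HomologicalComplex.exactAt_iff,
    ShortComplex.moduleCat_exact_iff]
  have hn : (ComplexShape.up ℕ).next i = i + 1 := by simp
  constructor
  · intro h φ hφ
    obtain ⟨ψ, hψ⟩ := h φ (by
      change (ConcreteCategory.hom ((P.complex.linearYonedaObj A Y).d i
        ((ComplexShape.up ℕ).next i))) φ = 0
      rw [hn]
      exact hφ)
    exact ⟨(ComplexShape.up ℕ).prev i, ψ, hψ⟩
  · intro h φ hφ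
    obtain ⟨j, ψ, hψ⟩ := h φ (by
      change (ConcreteCategory.hom ((P.complex.linearYonedaObj A Y).d i
        ((ComplexShape.up ℕ).next i))) φ = 0 at hφ
      rw [hn] at hφ
      exact hφ)
    by_cases hj : j = (ComplexShape.up ℕ).prev i
    · subst hj
      exact ⟨ψ, hψ⟩
    · refine ⟨0, ?_⟩
      rw [map_zero]
      refine Eq.trans ?_ hψ
      have hr : ¬ (ComplexShape.down ℕ).Rel i j := fun hr => hj
        ((ComplexShape.up ℕ).prev_eq' (j := j) (i := i) (by simpa using hr)).symm
      rw [P.complex.shape i j hr, Limits.zero_comp]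
      rfl

variable {X : ModuleCat.{0} A} {P : ProjectiveResolution X} {S : ShortComplex (ModuleCat.{0} A)}

namespace CocyclesBound

lemma middle (hS : S.ShortExact) {i : ℕ} (h₁ : CocyclesBound P i S.X₁)
    (h₃ : CocyclesBound P i S.X₃) : CocyclesBound P i S.X₂ := by
  have := hS.mono_f
  have := hS.epi_g
  intro φ hφ
  obtain ⟨j, ψ₃, hψ₃⟩ := h₃ (φ ≫ S.g) (by rw [← Category.assoc, hφ, Limits.zero_comp])
  let ψ := Projective.factorThru ψ₃ S.g
  have hψ : ψ ≫ S.g = ψ₃ := Projective.factorThru_comp _ _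
  have h0 : (φ - P.complex.d i j ≫ ψ) ≫ S.g = 0 := by
    simp [Preadditive.sub_comp, hψ, hψ₃]
  let χ := hS.exact.lift _ h0
  have hχ : χ ≫ S.f = φ - P.complex.d i j ≫ ψ := hS.exact.lift_f _ h0
  obtain ⟨j', ω, hω⟩ := h₁ χ (by
    rw [← cancel_mono S.f, Category.assoc, hχ, Preadditive.comp_sub, hφ]
    simp)
  by_cases hjj : (ComplexShape.down ℕ).Rel i j
  · by_cases hjj' : (ComplexShape.down ℕ).Rel i j'
    · obtain rfl : j = j' := by
        simp only [ComplexShape.down_Rel] at hjj hjj'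
        lia
      refine ⟨j, ω ≫ S.f + ψ, ?_⟩
      rw [Preadditive.comp_add, ← Category.assoc, hω, hχ, sub_add_cancel]
    · refine ⟨j, ψ, ?_⟩
      rw [P.complex.shape _ _ hjj', Limits.zero_comp] at hω
      rw [← hω, Limits.zero_comp] at hχ
      exact (sub_eq_zero.mp hχ.symm).symm
  · refine ⟨j', ω ≫ S.f, ?_⟩
    rw [← Category.assoc, hω, hχ, P.complex.shape _ _ hjj, Limits.zero_comp, sub_zero]

lemma left_zero (hS : S.ShortExact) (h₂ : CocyclesBound P 0 S.X₂) : CocyclesBound P 0 S.X₁ := by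
  have := hS.mono_f
  intro χ hχ
  obtain ⟨j, ψ, hψ⟩ := h₂ (χ ≫ S.f) (by rw [← Category.assoc, hχ, Limits.zero_comp])
  rw [P.complex.shape _ _ (by simp), Limits.zero_comp] at hψ
  refine ⟨0, 0, ?_⟩
  rw [← cancel_mono S.f, ← hψ]
  simp

lemma left_succ (hS : S.ShortExact) {i : ℕ} (h₂ : CocyclesBound P (i + 1) S.X₂)
    (h₃ : CocyclesBound P i S.X₃) : CocyclesBound P (i + 1) S.X₁ := by
  have := hS.mono_f
  have := hS.epi_g
  intro χ hχ
  obtain ⟨j, φ, hφ⟩ := h₂ (χ ≫ S.f) (by rw [← Category.assoc, hχ, Limits.zero_comp])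
  by_cases hj : (ComplexShape.down ℕ).Rel (i + 1) j
  · obtain rfl : j = i := by
      simp only [ComplexShape.down_Rel] at hj
      lia
    obtain ⟨j', ψ₃, hψ₃⟩ := h₃ (φ ≫ S.g) (by
      rw [← Category.assoc, hφ, Category.assoc, S.zero, Limits.comp_zero])
    let ψ := Projective.factorThru ψ₃ S.g
    have hψ : ψ ≫ S.g = ψ₃ := Projective.factorThru_comp _ _
    have h0 : (φ - P.complex.d j j' ≫ ψ) ≫ S.g = 0 := by
      simp [Preadditive.sub_comp, hψ, hψ₃]
    refine ⟨j, hS.exact.lift _ h0, ?_⟩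
    rw [← cancel_mono S.f, Category.assoc, hS.exact.lift_f, Preadditive.comp_sub, hφ]
    simp
  · rw [P.complex.shape _ _ hj, Limits.zero_comp] at hφ
    refine ⟨0, 0, ?_⟩
    rw [← cancel_mono S.f, ← hφ]
    simp

lemma right (hS : S.ShortExact) {i : ℕ} (h₂ : CocyclesBound P i S.X₂)
    (h₁ : CocyclesBound P (i + 1) S.X₁) : CocyclesBound P i S.X₃ := by
  have := hS.mono_f
  have := hS.epi_g
  intro φ₃ hφ₃
  let φ := Projective.factorThru φ₃ S.g
  have hφ : φ ≫ S.g = φ₃ := Projective.factorThru_comp _ _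
  have h0 : (P.complex.d (i + 1) i ≫ φ) ≫ S.g = 0 := by rw [Category.assoc, hφ, hφ₃]
  let χ := hS.exact.lift _ h0
  have hχ : χ ≫ S.f = P.complex.d (i + 1) i ≫ φ := hS.exact.lift_f _ h0
  obtain ⟨v, hv⟩ : ∃ v : P.complex.X i ⟶ S.X₁, P.complex.d (i + 1) i ≫ v = χ := by
    obtain ⟨j, v, hv⟩ := h₁ χ (by
      rw [← cancel_mono S.f, Category.assoc, hχ]
      simp)
    by_cases hj : (ComplexShape.down ℕ).Rel (i + 1) j
    · obtain rfl : j = i := by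
        simp only [ComplexShape.down_Rel] at hj
        lia
      exact ⟨v, hv⟩
    · rw [P.complex.shape _ _ hj, Limits.zero_comp] at hv
      exact ⟨0, by simp [← hv]⟩
  obtain ⟨j, ψ, hψ⟩ := h₂ (φ - v ≫ S.f) (by
    rw [Preadditive.comp_sub, ← Category.assoc, hv, hχ, sub_self])
  refine ⟨j, ψ ≫ S.g, ?_⟩
  rw [← Category.assoc, hψ, Preadditive.sub_comp, hφ, Category.assoc, S.zero]
  simp

/-- If `y` annihilates `X`, then multiplication by `y` is zero on the cohomology of `Hom(P, -)`. -/
lemma exists_smul_eq {y : A} (hy : y • 𝟙 X = 0) {Y : ModuleCat.{0} A} {i : ℕ}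
    (φ : P.complex.X (i + 1) ⟶ Y) (hφ : P.complex.d (i + 2) (i + 1) ≫ φ = 0) :
    ∃ ψ : P.complex.X i ⟶ Y, P.complex.d (i + 1) i ≫ ψ = y • φ := by
  have key : (y • 𝟙 P.complex) ≫ P.π = P.π ≫ (ChainComplex.single₀ _).map (y • 𝟙 X) := by
    have : (ChainComplex.single₀ (ModuleCat.{0} A)).map (y • 𝟙 X) = 0 := by rw [hy]; simp
    rw [this]
    ext : 1
    let π₀ : P.complex.X 0 ⟶ X := P.π.f 0
    have h : y • π₀ = 0 := by
      rw [← Category.comp_id π₀, ← Linear.comp_smul, hy, Limits.comp_zero]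
    rw [Limits.comp_zero, Linear.smul_comp, Category.id_comp]
    exact h
  let H := ProjectiveResolution.liftHomotopy (y • 𝟙 X) (y • 𝟙 P.complex) 0 key (by
    rw [hy]; simp)
  have hc := H.comm (i + 1)
  rw [Homotopy.dNext_succ_chainComplex, Homotopy.prevD_chainComplex] at hc
  refine ⟨H.hom i (i + 1) ≫ φ, ?_⟩
  have hc' : y • φ = (y • 𝟙 P.complex : P.complex ⟶ P.complex).f (i + 1) ≫ φ := by simp
  rw [hc', hc]
  simp [hφ]

lemma middle_of_smul {y : A} (hy : y • 𝟙 X = 0) {M N : ModuleCat.{0} A} (f : M ⟶ M) (g : M ⟶ N)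
    (hf : f = y • 𝟙 M) (w : f ≫ g = 0) (hS : (ShortComplex.mk f g w).ShortExact) {i : ℕ}
    (h₃ : CocyclesBound P i N) : CocyclesBound P (i + 1) M := by
  have hmono : Mono f := hS.mono_f
  have hepi : Epi g := hS.epi_g
  intro z hz
  obtain ⟨φ, hφ⟩ := exists_smul_eq hy z hz
  have hzf : y • z = z ≫ f := by rw [hf]; simp
  rw [hzf] at hφ
  obtain ⟨j', ψ₃, hψ₃⟩ := h₃ (φ ≫ g) (by
    rw [← Category.assoc, hφ, Category.assoc, w, Limits.comp_zero])
  let ψ := Projective.factorThru ψ₃ g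
  have hψ : ψ ≫ g = ψ₃ := Projective.factorThru_comp _ _
  have h0 : (φ - P.complex.d i j' ≫ ψ) ≫ g = 0 := by
    simp [Preadditive.sub_comp, hψ, hψ₃]
  refine ⟨i, hS.exact.lift _ h0, ?_⟩
  rw [← cancel_mono f, Category.assoc]
  erw [hS.exact.lift_f]
  rw [Preadditive.comp_sub, hφ]
  simp

lemma zero_iff {Y : ModuleCat.{0} A} : CocyclesBound P 0 Y ↔ Subsingleton (X ⟶ Y) := by
  constructor
  · intro h
    refine subsingleton_of_forall_eq 0 fun f => ?_
    let π₀ : P.complex.X 0 ⟶ X := P.π.f 0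
    have hπ₀ : P.complex.d 1 0 ≫ π₀ = 0 := P.complex_d_comp_π_f_zero
    have : Epi π₀ := inferInstanceAs (Epi (P.π.f 0))
    obtain ⟨j, ψ, hψ⟩ := h (π₀ ≫ f) (by
      rw [← Category.assoc, hπ₀, Limits.zero_comp])
    rw [P.complex.shape _ _ (by simp), Limits.zero_comp] at hψ
    rw [← cancel_epi π₀, ← hψ]
    simp
  · intro h φ hφ
    refine ⟨0, 0, ?_⟩
    have h1 := P.isColimitCokernelCofork.fac (Limits.CokernelCofork.ofπ φ hφ)
      Limits.WalkingParallelPair.one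
    have h2 : P.isColimitCokernelCofork.desc (Limits.CokernelCofork.ofπ φ hφ) = 0 :=
      Subsingleton.elim (α := X ⟶ Y) _ _
    rw [h2] at h1
    simp only [Limits.comp_zero] at h1 ⊢
    exact h1

end CocyclesBound


variable {M N Q : Type} [AddCommGroup M] [Module A M] [AddCommGroup N] [Module A N]
  [AddCommGroup Q] [Module A Q]

lemma shortExact_ofHom {f : M →ₗ[A] N} {g : N →ₗ[A] Q} (hf : Function.Injective f)
    (hfg : Function.Exact f g) (hg : Function.Surjective g) :
    (ShortComplex.mk (ModuleCat.ofHom f) (ModuleCat.ofHom g) (by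
      rw [← ModuleCat.ofHom_comp, hfg.linearMap_comp_eq_zero]; rfl)).ShortExact where
  exact := by
    rw [ShortComplex.moduleCat_exact_iff]
    exact fun x hx => (hfg x).mp hx
  mono_f := (ModuleCat.mono_iff_injective _).mpr hf
  epi_g := (ModuleCat.epi_iff_surjective _).mpr hg

lemma extVanishes_iff_cocyclesBound (m : Ideal A) (i : ℕ) :
    ExtVanishes m i M ↔
      CocyclesBound (projectiveResolution (ModuleCat.of A (A ⧸ m))) i (ModuleCat.of A M) :=
  subsingleton_Ext_iff _ _ _

lemma extVanishes_of_subsingleton [Subsingleton M] (m : Ideal A) (i : ℕ) : ExtVanishes m i M := by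
  rw [extVanishes_iff_cocyclesBound]
  refine fun φ _ => ⟨0, 0, ?_⟩
  ext x
  exact Subsingleton.elim (α := M) _ _

lemma extVanishes_zero_iff (m : Ideal A) :
    ExtVanishes m 0 M ↔ ∀ z : M, (∀ y ∈ m, y • z = 0) → z = 0 := by
  rw [extVanishes_iff_cocyclesBound, CocyclesBound.zero_iff,
    ModuleCat.homEquiv.subsingleton_congr]
  constructor
  · intro h z hz
    have h1 : m ≤ LinearMap.ker (LinearMap.toSpanSingleton A M z) := fun y hy => by
      simpa using hz y hy
    have h2 := LinearMap.congr_fun (Subsingleton.elim (Submodule.liftQ m _ h1) 0)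
      (Submodule.Quotient.mk 1)
    change (1 : A) • z = 0 at h2
    rwa [one_smul] at h2
  · intro h
    refine subsingleton_of_forall_eq 0 fun f => ?_
    refine Submodule.linearMap_qext _ (LinearMap.ext_ring ?_)
    refine h _ fun y hy => ?_
    rw [← map_smul]
    have : (Submodule.mkQ m) y = 0 := (Submodule.Quotient.mk_eq_zero m).mpr hy
    simp only [LinearMap.comp_apply, smul_eq_mul, mul_one, this, map_zero]

namespace ExtVanishes

variable {m : Ideal A} {f : M →ₗ[A] N} {g : N →ₗ[A] Q}

lemma middle (hf : Function.Injective f) (hfg : Function.Exact f g) (hg : Function.Surjective g)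
    {i : ℕ} (h₁ : ExtVanishes m i M) (h₃ : ExtVanishes m i Q) : ExtVanishes m i N := by
  rw [extVanishes_iff_cocyclesBound] at *
  exact CocyclesBound.middle (shortExact_ofHom hf hfg hg) h₁ h₃

lemma right (hf : Function.Injective f) (hfg : Function.Exact f g) (hg : Function.Surjective g)
    {i : ℕ} (h₂ : ExtVanishes m i N) (h₁ : ExtVanishes m (i + 1) M) : ExtVanishes m i Q := by
  rw [extVanishes_iff_cocyclesBound] at *
  exact CocyclesBound.right (shortExact_ofHom hf hfg hg) h₂ h₁

/-- The depth lemma for the first term of a short exact sequence. -/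
lemma left (hf : Function.Injective f) (hfg : Function.Exact f g) (hg : Function.Surjective g)
    {r : ℕ} (h₂ : ∀ i < r, ExtVanishes m i N) (h₃ : ∀ i, i + 1 < r → ExtVanishes m i Q) :
    ∀ i < r, ExtVanishes m i M := by
  intro i hi
  cases i with
  | zero =>
    have := h₂ 0 hi
    rw [extVanishes_iff_cocyclesBound] at *
    exact CocyclesBound.left_zero (shortExact_ofHom hf hfg hg) this
  | succ i =>
    have h₂' := h₂ _ hi
    have h₃' := h₃ _ hi
    rw [extVanishes_iff_cocyclesBound] at *
    exact CocyclesBound.left_succ (shortExact_ofHom hf hfg hg) h₂' h₃'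

lemma succ_of_smul {y : A} (hy : y ∈ m) {f : M →ₗ[A] M} {g : M →ₗ[A] Q} (hfy : ∀ z, f z = y • z)
    (hf : Function.Injective f) (hfg : Function.Exact f g) (hg : Function.Surjective g)
    {i : ℕ} (h₃ : ExtVanishes m i Q) : ExtVanishes m (i + 1) M := by
  rw [extVanishes_iff_cocyclesBound] at *
  refine CocyclesBound.middle_of_smul (y := y) ?_ _ _ ?_ _ (shortExact_ofHom hf hfg hg) h₃
  · ext : 1
    refine Submodule.linearMap_qext _ (LinearMap.ext_ring ?_)
    change y • (Submodule.Quotient.mk (p := m) (1 : A)) = 0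
    rw [← Submodule.Quotient.mk_smul, Submodule.Quotient.mk_eq_zero]
    simpa using hy
  · ext z
    exact hfy z

end ExtVanishes

lemma natCast_le_depthOf_iff (m : Ideal A) (r : ℕ) :
    (r : ℕ∞) ≤ depthOf A m M ↔ ∀ i < r, ExtVanishes m i M := by
  unfold depthOf ExtVanishes
  simp only [le_sInf_iff, Set.forall_mem_image, Set.mem_ofPred_eq, Nat.cast_le]
  constructor
  · intro h i hi
    by_contra hc
    exact absurd (h (not_subsingleton_iff_nontrivial.mp hc)) (by lia)
  · intro h i hi
    by_contra hc
    exact not_subsingleton_iff_nontrivial.mpr hi (h i (by lia))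

end ExtVanishing

section Koszul

variable {A : Type} [CommRing A]

/-- The total module of the Koszul cochain complex of a list of ring elements on `M`, built as an
iterated mapping cone. -/
def Koszul (M : Type) : List A → Type
  | [] => M
  | _ :: l => Koszul M l × Koszul M l

namespace Koszul

section Basic

variable (M : Type) [AddCommGroup M] [Module A M]

instance instAddCommGroup : (l : List A) → AddCommGroup (Koszul M l)
  | [] => inferInstanceAs (AddCommGroup M)
  | _ :: l =>
    letI := instAddCommGroup l
    inferInstanceAs (AddCommGroup (Koszul M l × Koszul M l))

instance instModule : (l : List A) → Module A (Koszul M l)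
  | [] => inferInstanceAs (Module A M)
  | _ :: l =>
    letI := instModule l
    inferInstanceAs (Module A (Koszul M l × Koszul M l))

/-- The Koszul differential. -/
def d : (l : List A) → Koszul M l →ₗ[A] Koszul M l
  | [] => 0
  | x :: l =>
    (LinearMap.prod ((d l).comp (LinearMap.fst A _ _))
      (x • LinearMap.fst A _ _ - (d l).comp (LinearMap.snd A _ _)) :
      Koszul M l × Koszul M l →ₗ[A] Koszul M l × Koszul M l)

/-- The cochains of degree `i`. -/
def deg : (l : List A) → ℤ → Submodule A (Koszul M l)
  | [], i => if i = 0 then ⊤ else ⊥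
  | _ :: l, i => (Submodule.prod (deg l i) (deg l (i - 1)) :
      Submodule A (Koszul M l × Koszul M l))

variable {M}

lemma d_cons (x : A) (l : List A) (a b : Koszul M l) :
    d M (x :: l) (a, b) = (d M l a, x • a - d M l b) := rfl

lemma mem_deg_cons {x : A} {l : List A} {i : ℤ} {a b : Koszul M l} :
    (show Koszul M (x :: l) from (a, b)) ∈ deg M (x :: l) i ↔
      a ∈ deg M l i ∧ b ∈ deg M l (i - 1) := Iff.rfl

lemma d_d : (l : List A) → (z : Koszul M l) → d M l (d M l z) = 0
  | [], _ => rfl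
  | x :: l, (a, b) => by
    rw [d_cons, d_cons, d_d l a, map_sub, map_smul, d_d l b, sub_zero, sub_self]
    rfl

lemma d_mem_deg : (l : List A) → (i : ℤ) → (z : Koszul M l) → z ∈ deg M l i →
    d M l z ∈ deg M l (i + 1)
  | [], _, _, _ => Submodule.zero_mem _
  | x :: l, i, (a, b), h => by
    obtain ⟨ha, hb⟩ := mem_deg_cons.mp h
    have h1 := d_mem_deg l i a ha
    have h2 := d_mem_deg l (i - 1) b hb
    rw [sub_add_cancel] at h2
    refine mem_deg_cons.mpr ⟨h1, ?_⟩
    rw [add_sub_cancel_right]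
    exact Submodule.sub_mem _ (Submodule.smul_mem _ _ ha) h2

lemma deg_neg : (l : List A) → (i : ℤ) → i < 0 → (z : Koszul M l) → z ∈ deg M l i → z = 0
  | [], i, hi, z, h => by
    rw [deg, if_neg hi.ne] at h
    exact h
  | x :: l, i, hi, (a, b), h => by
    obtain ⟨ha, hb⟩ := mem_deg_cons.mp h
    rw [deg_neg l i hi a ha, deg_neg l (i - 1) (by lia) b hb]
    rfl

lemma deg_gt : (l : List A) → (i : ℤ) → l.length < i → (z : Koszul M l) → z ∈ deg M l i → z = 0
  | [], i, hi, z, h => by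
    rw [deg, if_neg (by simpa using hi.ne')] at h
    exact h
  | x :: l, i, hi, (a, b), h => by
    obtain ⟨ha, hb⟩ := mem_deg_cons.mp h
    rw [List.length_cons] at hi
    rw [deg_gt l i (by lia) a ha, deg_gt l (i - 1) (by lia) b hb]
    rfl

/-- The inclusion of the cochains of degree zero. -/
def bot : (l : List A) → M →ₗ[A] Koszul M l
  | [] => LinearMap.id
  | _ :: l => (LinearMap.inl A (Koszul M l) (Koszul M l)).comp (bot l)

/-- The inclusion of the cochains of degree `l.length`. -/
def top : (l : List A) → M →ₗ[A] Koszul M l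
  | [] => LinearMap.id
  | _ :: l => (LinearMap.inr A (Koszul M l) (Koszul M l)).comp (top l)

lemma bot_cons (x : A) (l : List A) (u : M) : bot (x :: l) u = (bot l u, 0) := rfl

lemma top_cons (x : A) (l : List A) (u : M) : top (x :: l) u = (0, top l u) := rfl

lemma bot_injective : (l : List A) → Function.Injective (bot l : M → Koszul M l)
  | [] => fun _ _ h => h
  | _ :: l => fun _ _ h => bot_injective l (congrArg Prod.fst h)

lemma bot_mem_deg : (l : List A) → (u : M) → bot l u ∈ deg M l 0
  | [], u => by
    rw [deg, if_pos rfl]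
    exact Submodule.mem_top
  | _ :: l, u => mem_deg_cons.mpr ⟨bot_mem_deg l u, Submodule.zero_mem _⟩

lemma top_mem_deg : (l : List A) → (u : M) → top l u ∈ deg M l l.length
  | [], u => by
    rw [deg, if_pos (by simp)]
    exact Submodule.mem_top
  | x :: l, u => by
    refine mem_deg_cons.mpr ⟨Submodule.zero_mem _, ?_⟩
    simpa using top_mem_deg l u

lemma d_bot : (l : List A) → (u : M) → (∀ x ∈ l, x • u = 0) → d M l (bot l u) = 0
  | [], _, _ => rfl
  | x :: l, u, h => by
    rw [bot_cons, d_cons, d_bot l u fun y hy => h y (List.mem_cons_of_mem _ hy), ← map_smul,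
      h x List.mem_cons_self, map_zero, map_zero, sub_zero]
    rfl

lemma d_top : (l : List A) → (u : M) → d M l (top l u) = 0
  | [], _ => rfl
  | x :: l, u => by
    rw [top_cons, d_cons, d_top l u, map_zero, smul_zero, sub_zero]
    rfl

lemma exists_bot : (l : List A) → (z : Koszul M l) → z ∈ deg M l 0 → d M l z = 0 →
    ∃ u, bot l u = z ∧ ∀ x ∈ l, x • u = 0
  | [], z, _, _ => ⟨z, rfl, by simp⟩
  | x :: l, (a, b), h, hd => by
    obtain ⟨ha, hb⟩ := mem_deg_cons.mp h
    obtain rfl := deg_neg l _ (by lia) b hb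
    rw [d_cons, map_zero, sub_zero] at hd
    obtain ⟨u, rfl, hu⟩ := exists_bot l a ha (congrArg Prod.fst hd)
    refine ⟨u, rfl, fun y hy => ?_⟩
    rcases List.mem_cons.mp hy with rfl | hy
    · apply bot_injective l
      rw [map_smul, map_zero]
      exact congrArg Prod.snd hd
    · exact hu y hy

lemma exists_top : (l : List A) → (z : Koszul M l) → z ∈ deg M l l.length → ∃ u, top l u = z
  | [], z, _ => ⟨z, rfl⟩
  | x :: l, (a, b), h => by
    obtain ⟨ha, hb⟩ := mem_deg_cons.mp h
    obtain rfl := deg_gt l _ (by simp) a ha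
    obtain ⟨u, rfl⟩ := exists_top l b (by simpa using hb)
    exact ⟨u, rfl⟩

lemma mem_smul_top_of_d_eq_top : (l : List A) → (u : M) → (w : Koszul M l) →
    w ∈ deg M l (l.length - 1) → d M l w = top l u →
    u ∈ Ideal.span {x | x ∈ l} • (⊤ : Submodule A M)
  | [], u, w, _, hd => by
    obtain rfl : 0 = u := hd
    exact Submodule.zero_mem _
  | x :: l, u, (a, b), h, hd => by
    obtain ⟨ha, hb⟩ := mem_deg_cons.mp h
    obtain ⟨v, rfl⟩ := exists_top l a (by simpa using ha)
    have h2 : x • top l v - d M l b = top l u := congrArg Prod.snd hd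
    have h3 := mem_smul_top_of_d_eq_top l (x • v - u) b (by simpa using hb) (by
      rw [map_sub, map_smul, ← h2]
      abel)
    have h4 : x • v ∈ Ideal.span {y | y ∈ x :: l} • (⊤ : Submodule A M) :=
      Submodule.smul_mem_smul (Ideal.subset_span List.mem_cons_self) Submodule.mem_top
    have h5 := Submodule.sub_mem _ h4 (Submodule.smul_mono_left
      (Ideal.span_mono fun y hy => List.mem_cons_of_mem x hy) h3)
    simpa using h5

lemma exists_contraction_of_mem : (l : List A) → (x : A) → x ∈ l →
    ∃ c : Koszul M l →ₗ[A] Koszul M l, (∀ i, ∀ z ∈ deg M l i, c z ∈ deg M l (i - 1)) ∧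
      ∀ z, d M l (c z) + c (d M l z) = x • z
  | y :: l, x, hx => by
    by_cases hxy : x = y
    · subst hxy
      refine ⟨(LinearMap.inl A (Koszul M l) (Koszul M l)).comp
        (LinearMap.snd A (Koszul M l) (Koszul M l)), ?_, ?_⟩
      · rintro i ⟨a, b⟩ h
        exact mem_deg_cons.mpr ⟨(mem_deg_cons.mp h).2, Submodule.zero_mem _⟩
      · rintro ⟨a, b⟩
        change ((d M l b, x • b - d M l 0) : Koszul M l × Koszul M l) + (x • a - d M l b, 0) =
          (x • a, x • b)
        rw [map_zero, sub_zero]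
        exact Prod.ext (add_sub_cancel _ _) (add_zero _)
    · obtain ⟨c, hc, hd⟩ := exists_contraction_of_mem l x
        ((List.mem_cons.mp hx).resolve_left hxy)
      refine ⟨c.prodMap (-c), ?_, ?_⟩
      · rintro i ⟨a, b⟩ h
        exact mem_deg_cons.mpr ⟨hc _ _ (mem_deg_cons.mp h).1,
          Submodule.neg_mem _ (hc _ _ (mem_deg_cons.mp h).2)⟩
      · rintro ⟨a, b⟩
        change ((d M l (c a), y • c a - d M l (-c b)) : Koszul M l × Koszul M l) +
          (c (d M l a), -c (y • a - d M l b)) = (x • a, x • b)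
        rw [← hd a, ← hd b]
        simp only [map_neg, map_sub, map_smul, Prod.mk_add_mk, Prod.mk.injEq, true_and]
        abel

lemma exists_contraction {l : List A} {y : A} (hy : y ∈ Ideal.span {x | x ∈ l}) :
    ∃ c : Koszul M l →ₗ[A] Koszul M l, (∀ i, ∀ z ∈ deg M l i, c z ∈ deg M l (i - 1)) ∧
      ∀ z, d M l (c z) + c (d M l z) = y • z := by
  induction hy using Submodule.span_induction with
  | mem x hx => exact exists_contraction_of_mem l x hx
  | zero => exact ⟨0, fun _ _ _ => Submodule.zero_mem _, fun _ => by simp⟩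
  | add x y _ _ hx hy =>
    obtain ⟨c, hc, hd⟩ := hx
    obtain ⟨c', hc', hd'⟩ := hy
    refine ⟨c + c', fun i z hz => Submodule.add_mem _ (hc i z hz) (hc' i z hz), fun z => ?_⟩
    rw [add_smul, ← hd, ← hd']
    simp only [LinearMap.add_apply, map_add]
    abel
  | smul a x _ hx =>
    obtain ⟨c, hc, hd⟩ := hx
    refine ⟨a • c, fun i z hz => Submodule.smul_mem _ _ (hc i z hz), fun z => ?_⟩
    rw [smul_assoc, ← hd]
    simp

end Basic

section Map

variable {M N Q : Type} [AddCommGroup M] [Module A M] [AddCommGroup N] [Module A N]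
  [AddCommGroup Q] [Module A Q]

/-- The map on Koszul cochains induced by an additive map. -/
def map (f : M →+ N) : (l : List A) → Koszul M l →+ Koszul N l
  | [] => f
  | _ :: l => (map f l).prodMap (map f l)

lemma map_cons (f : M →+ N) (x : A) (l : List A) (a b : Koszul M l) :
    map f (x :: l) (a, b) = (map f l a, map f l b) := rfl

lemma map_smul_of_commute {x y : A} {f g : M →+ N} (hf : ∀ z, f (x • z) = y • g z) :
    (l : List A) → (z : Koszul M l) → map f l (x • z) = y • map g l z
  | [], z => hf z
  | _ :: l, (a, b) =>
    Prod.ext (map_smul_of_commute hf l a) (map_smul_of_commute hf l b)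

lemma map_d {f : M →+ N} : (l : List A) → (∀ x ∈ l, ∀ z, f (x • z) = x • f z) →
    (z : Koszul M l) → map f l (d M l z) = d N l (map f l z)
  | [], _, _ => map_zero f
  | x :: l, hf, (a, b) => by
    have ih := map_d l fun y hy => hf y (List.mem_cons_of_mem x hy)
    rw [d_cons, map_cons, map_cons, d_cons, map_sub, ih a, ih b,
      map_smul_of_commute (hf x List.mem_cons_self)]

lemma map_d_of_linear (f : M →ₗ[A] N) (l : List A) (z : Koszul M l) :
    map f.toAddMonoidHom l (d M l z) = d N l (map f.toAddMonoidHom l z) :=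
  map_d l (fun x _ z => f.map_smul x z) z

lemma map_mem_deg (f : M →+ N) : (l : List A) → (i : ℤ) → (z : Koszul M l) → z ∈ deg M l i →
    map f l z ∈ deg N l i
  | [], i, z, h => by
    by_cases hi : i = 0
    · rw [deg, if_pos hi]
      exact Submodule.mem_top
    · rw [deg, if_neg hi] at h ⊢
      rw [(Submodule.mem_bot A).mp h, map_zero]
      exact Submodule.zero_mem _
  | x :: l, i, (a, b), h =>
    mem_deg_cons.mpr ⟨map_mem_deg f l i a (mem_deg_cons.mp h).1,
      map_mem_deg f l (i - 1) b (mem_deg_cons.mp h).2⟩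

lemma map_injective {f : M →+ N} (hf : Function.Injective f) :
    (l : List A) → Function.Injective (map f l)
  | [] => hf
  | _ :: l => (map_injective hf l).prodMap (map_injective hf l)

lemma exists_map_eq_of_surjective {f : M →+ N} (hf : Function.Surjective f) :
    (l : List A) → (i : ℤ) → (z : Koszul N l) → z ∈ deg N l i → ∃ w ∈ deg M l i, map f l w = z
  | [], i, z, h => by
    by_cases hi : i = 0
    · obtain ⟨w, hw⟩ := hf z
      refine ⟨w, ?_, hw⟩
      rw [deg, if_pos hi]
      exact Submodule.mem_top
    · rw [deg, if_neg hi] at h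
      exact ⟨0, Submodule.zero_mem _, (map_zero f).trans ((Submodule.mem_bot A).mp h).symm⟩
  | x :: l, i, (a, b), h => by
    obtain ⟨u, hu, rfl⟩ := exists_map_eq_of_surjective hf l i a (mem_deg_cons.mp h).1
    obtain ⟨v, hv, rfl⟩ := exists_map_eq_of_surjective hf l (i - 1) b (mem_deg_cons.mp h).2
    exact ⟨(u, v), mem_deg_cons.mpr ⟨hu, hv⟩, rfl⟩

lemma exists_map_eq_of_exact {f : M →+ N} {g : N →+ Q} (hfg : Function.Exact f g) :
    (l : List A) → (i : ℤ) → (z : Koszul N l) → z ∈ deg N l i → map g l z = 0 →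
      ∃ w ∈ deg M l i, map f l w = z
  | [], i, z, h, hz => by
    by_cases hi : i = 0
    · obtain ⟨w, hw⟩ := (hfg z).mp hz
      refine ⟨w, ?_, hw⟩
      rw [deg, if_pos hi]
      exact Submodule.mem_top
    · rw [deg, if_neg hi] at h
      exact ⟨0, Submodule.zero_mem _, (map_zero f).trans ((Submodule.mem_bot A).mp h).symm⟩
  | x :: l, i, (a, b), h, hz => by
    obtain ⟨u, hu, rfl⟩ := exists_map_eq_of_exact hfg l i a (mem_deg_cons.mp h).1
      (congrArg Prod.fst hz)
    obtain ⟨v, hv, rfl⟩ := exists_map_eq_of_exact hfg l (i - 1) b (mem_deg_cons.mp h).2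
      (congrArg Prod.snd hz)
    exact ⟨(u, v), mem_deg_cons.mpr ⟨hu, hv⟩, rfl⟩

lemma map_comp (f : M →+ N) (g : N →+ Q) : (l : List A) → (z : Koszul M l) →
    map (g.comp f) l z = map g l (map f l z)
  | [], _ => rfl
  | _ :: l, (a, b) => Prod.ext (map_comp f g l a) (map_comp f g l b)

lemma map_id : (l : List A) → (z : Koszul M l) → map (AddMonoidHom.id M) l z = z
  | [], _ => rfl
  | _ :: l, (a, b) => Prod.ext (map_id l a) (map_id l b)

lemma map_sub_apply (f g : M →+ N) : (l : List A) → (z : Koszul M l) →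
    map (f - g) l z = map f l z - map g l z
  | [], _ => rfl
  | _ :: l, (a, b) => Prod.ext (map_sub_apply f g l a) (map_sub_apply f g l b)

lemma map_eq_zero {f : M →+ N} (hf : ∀ z, f z = 0) : (l : List A) → (z : Koszul M l) →
    map f l z = 0
  | [], z => hf z
  | _ :: l, (a, b) => Prod.ext (map_eq_zero hf l a) (map_eq_zero hf l b)

/-- Division operators for the entries of `l` make a map of modules null-homotopic on Koszul
cohomology below the top degree. -/
lemma exists_d_eq_map (ι : M →+ N) (D : A → M →+ N) (π : A → M →+ M) :
    (l : List A) → l.Nodup →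
    (∀ x ∈ l, ∀ z, D x (x • z) = ι z) →
    (∀ x ∈ l, ∀ z, x • D x z = ι z - ι (π x z)) →
    (∀ x ∈ l, ∀ y ∈ l, x ≠ y → ∀ z, D x (y • z) = y • D x z) →
    (∀ x ∈ l, ∀ y ∈ l, x ≠ y → ∀ z, π x (y • z) = y • π x z) →
    (∀ x ∈ l, ∀ z, π x (x • z) = 0) →
    (i : ℤ) → i < l.length → (z : Koszul M l) → z ∈ deg M l i → d M l z = 0 →
      ∃ w ∈ deg N l (i - 1), d N l w = map ι l z
  | [], _, _, _, _, _, _, i, hi, z, hz, _ => by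
    refine ⟨0, Submodule.zero_mem _, ?_⟩
    rw [deg_neg [] i (by simpa using hi) z hz, map_zero, map_zero]
  | x :: l, hl, h₁, h₂, h₃, h₄, h₅, i, hi, (a, b), hz, hd => by
    obtain ⟨hxl, hl⟩ := List.nodup_cons.mp hl
    have hx : x ∈ x :: l := List.mem_cons_self
    have mem {y : A} (hy : y ∈ l) : y ∈ x :: l := List.mem_cons_of_mem x hy
    have ne {y : A} (hy : y ∈ l) : x ≠ y := fun h => hxl (h ▸ hy)
    obtain ⟨-, hb⟩ := mem_deg_cons.mp hz
    have hab : x • a - d M l b = 0 := congrArg Prod.snd hd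
    have hπ : d M l (map (π x) l b) = 0 := by
      rw [← map_d l fun y hy => h₄ x hx y (mem hy) (ne hy), ← sub_eq_zero.mp hab]
      rw [map_smul_of_commute (y := 0) (g := 0) (fun z => by simp [h₅ x hx z]), zero_smul]
    obtain ⟨c, hc, hdc⟩ := exists_d_eq_map ι D π l hl (fun y hy => h₁ y (mem hy))
      (fun y hy => h₂ y (mem hy)) (fun y hy u hu => h₃ y (mem hy) u (mem hu))
      (fun y hy u hu => h₄ y (mem hy) u (mem hu)) (fun y hy => h₅ y (mem hy)) (i - 1)
      (by rw [List.length_cons] at hi; lia) _ (map_mem_deg (π x) l _ b hb) hπ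
    refine ⟨(map (D x) l b, -c), mem_deg_cons.mpr
      ⟨map_mem_deg _ _ _ _ hb, Submodule.neg_mem _ hc⟩, ?_⟩
    rw [d_cons, map_cons]
    refine Prod.ext ?_ ?_
    · change d N l (map (D x) l b) = map ι l a
      rw [← map_d l fun y hy => h₃ x hx y (mem hy) (ne hy), ← sub_eq_zero.mp hab]
      rw [map_smul_of_commute (y := 1) (g := ι) (fun z => by simp [h₁ x hx z]), one_smul]
    · change x • map (D x) l b - d N l (-c) = map ι l b
      rw [← map_smul_of_commute (f := ι - ι.comp (π x)) (x := 1) (fun z => by simp [h₂ x hx z]),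
        one_smul, map_neg, hdc, map_sub_apply, map_comp]
      abel

end Map

end Koszul

end Koszul

section KoszulVanishing

variable {A : Type} [CommRing A]

/-- The Koszul cohomology of `M` with respect to `l` vanishes in degree `i`. -/
def KoszulVanishes (l : List A) (i : ℤ) (M : Type) [AddCommGroup M] [Module A M] : Prop :=
  ∀ z ∈ Koszul.deg M l i, Koszul.d M l z = 0 → ∃ w ∈ Koszul.deg M l (i - 1), Koszul.d M l w = z

variable {l : List A} {M N Q : Type} [AddCommGroup M] [Module A M] [AddCommGroup N] [Module A N]
  [AddCommGroup Q] [Module A Q]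

lemma koszulVanishes_zero_iff :
    KoszulVanishes l 0 M ↔ ∀ z : M, (∀ y ∈ Ideal.span {x | x ∈ l}, y • z = 0) → z = 0 := by
  constructor
  · intro h z hz
    obtain ⟨w, hw, hwz⟩ := h (Koszul.bot l z) (Koszul.bot_mem_deg l z)
      (Koszul.d_bot l z fun x hx => hz x (Ideal.subset_span hx))
    rw [Koszul.deg_neg l _ (by lia) w hw, map_zero] at hwz
    exact Koszul.bot_injective l (by rw [← hwz, map_zero])
  · intro h z hz hd
    obtain ⟨u, rfl, hu⟩ := Koszul.exists_bot l z hz hd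
    refine ⟨0, Submodule.zero_mem _, ?_⟩
    have h1 : Ideal.span {x | x ∈ l} ≤ LinearMap.ker (LinearMap.toSpanSingleton A M u) :=
      Ideal.span_le.mpr fun x hx => by simpa using hu x hx
    rw [h u fun y hy => by simpa using h1 hy, map_zero, map_zero]

namespace KoszulVanishes

variable {f : M →ₗ[A] N} {g : N →ₗ[A] Q}

lemma right (hf : Function.Injective f) (hfg : Function.Exact f g) (hg : Function.Surjective g)
    {i : ℤ} (h₂ : KoszulVanishes l i N) (h₁ : KoszulVanishes l (i + 1) M) :
    KoszulVanishes l i Q := by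
  intro z hz hd
  obtain ⟨v, hv, rfl⟩ := Koszul.exists_map_eq_of_surjective (f := g.toAddMonoidHom) hg l i z hz
  rw [← Koszul.map_d_of_linear] at hd
  obtain ⟨u, hu, huv⟩ := Koszul.exists_map_eq_of_exact (f := f.toAddMonoidHom)
    (g := g.toAddMonoidHom) hfg l (i + 1) _ (Koszul.d_mem_deg l i v hv) hd
  obtain ⟨w, hw, rfl⟩ := h₁ u hu (Koszul.map_injective (f := f.toAddMonoidHom) hf l (by
    rw [Koszul.map_d_of_linear, huv, Koszul.d_d, map_zero]))
  rw [add_sub_cancel_right] at hw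
  rw [Koszul.map_d_of_linear] at huv
  obtain ⟨t, ht, htv⟩ := h₂ (v - Koszul.map f.toAddMonoidHom l w)
    (Submodule.sub_mem _ hv (Koszul.map_mem_deg _ l i w hw)) (by rw [map_sub, huv, sub_self])
  refine ⟨Koszul.map g.toAddMonoidHom l t, Koszul.map_mem_deg _ l _ t ht, ?_⟩
  rw [← Koszul.map_d_of_linear, htv, map_sub, ← Koszul.map_comp,
    Koszul.map_eq_zero (fun x => hfg.apply_apply_eq_zero x), sub_zero]

lemma succ_of_smul {y : A} (hy : y ∈ Ideal.span {x | x ∈ l}) {f : M →ₗ[A] M} {g : M →ₗ[A] Q}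
    (hfy : ∀ z, f z = y • z)
    (hf : Function.Injective f) (hfg : Function.Exact f g) (hg : Function.Surjective g)
    {i : ℤ} (h₃ : KoszulVanishes l i Q) : KoszulVanishes l (i + 1) M := by
  intro z hz hd
  obtain ⟨c, hc, hdc⟩ := Koszul.exists_contraction (M := M) hy
  have hcz := hdc z
  rw [hd, map_zero, add_zero] at hcz
  have hw := hc _ z hz
  rw [add_sub_cancel_right] at hw
  have hfl (v : Koszul M l) : Koszul.map f.toAddMonoidHom l v = y • v := by
    rw [← one_smul A v, Koszul.map_smul_of_commute (y := y) (g := AddMonoidHom.id M)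
      (fun u => by simpa using hfy u), Koszul.map_id, one_smul]
  have hgf (v : Koszul M l) : Koszul.map g.toAddMonoidHom l (y • v) = 0 := by
    rw [← hfl, ← Koszul.map_comp, Koszul.map_eq_zero (fun x => hfg.apply_apply_eq_zero x)]
  obtain ⟨t, ht, htw⟩ := h₃ (Koszul.map g.toAddMonoidHom l (c z))
    (Koszul.map_mem_deg _ l _ _ hw) (by rw [← Koszul.map_d_of_linear, hcz, hgf])
  obtain ⟨v, hv, rfl⟩ := Koszul.exists_map_eq_of_surjective (f := g.toAddMonoidHom) hg l _ t ht
  obtain ⟨u, hu, huw⟩ := Koszul.exists_map_eq_of_exact (f := f.toAddMonoidHom)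
    (g := g.toAddMonoidHom) hfg l i (c z - Koszul.d M l v) (Submodule.sub_mem _ hw (by
      simpa using Koszul.d_mem_deg l _ v hv)) (by
      rw [map_sub, Koszul.map_d_of_linear, htw, sub_self])
  refine ⟨u, by simpa using hu, Koszul.map_injective (f := f.toAddMonoidHom) hf l ?_⟩
  rw [Koszul.map_d_of_linear, huw, map_sub, Koszul.d_d, sub_zero, hcz, hfl]

end KoszulVanishes

/-- Multiplication by a regular element and reduction modulo it form an exact sequence. -/
lemma exact_smul_mkQ (M : Type) [AddCommGroup M] [Module A M] (y : A) :
    Function.Exact (LinearMap.lsmul A M y) (Submodule.mkQ (y • (⊤ : Submodule A M))) := by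
  intro z
  rw [← LinearMap.mem_ker, Submodule.ker_mkQ, Submodule.mem_smul_pointwise_iff_exists]
  simp

lemma ExtVanishes.forall_lt_succ_iff_of_exact {m : Ideal A} {y : A} (hy : y ∈ m)
    {f : M →ₗ[A] M} {g : M →ₗ[A] Q} (hfy : ∀ z, f z = y • z) (hf : Function.Injective f)
    (hfg : Function.Exact f g) (hg : Function.Surjective g) (r : ℕ) :
    (∀ i < r + 1, ExtVanishes m i M) ↔ ∀ i < r, ExtVanishes m i Q := by
  constructor
  · exact fun h i hi => .right hf hfg hg (h i (by lia)) (h (i + 1) (by lia))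
  · intro h i hi
    cases i with
    | zero =>
      refine (extVanishes_zero_iff m).mpr fun z hz => hf ?_
      rw [hfy, hz y hy, map_zero]
    | succ i => exact .succ_of_smul hy hfy hf hfg hg (h i (by lia))

lemma ExtVanishes.forall_lt_succ_iff {m : Ideal A} {y : A} (hy : y ∈ m)
    (hreg : IsSMulRegular M y) (r : ℕ) :
    (∀ i < r + 1, ExtVanishes m i M) ↔ ∀ i < r, ExtVanishes m i (QuotSMulTop y M) :=
  ExtVanishes.forall_lt_succ_iff_of_exact hy (f := LinearMap.lsmul A M y) (fun _ => rfl) hreg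
    (exact_smul_mkQ M y) (Submodule.mkQ_surjective _) r

lemma KoszulVanishes.forall_lt_succ_iff {y : A} (hy : y ∈ Ideal.span {x | x ∈ l})
    (hreg : IsSMulRegular M y) (r : ℕ) :
    (∀ i < r + 1, KoszulVanishes l (i : ℕ) M) ↔
      ∀ i < r, KoszulVanishes l (i : ℕ) (QuotSMulTop y M) := by
  have hinj : Function.Injective (LinearMap.lsmul A M y) := hreg
  have hex := exact_smul_mkQ M y
  have hsurj := Submodule.mkQ_surjective (y • (⊤ : Submodule A M))
  constructor
  · exact fun h i hi => .right hinj hex hsurj (h i (by lia)) (h (i + 1) (by lia))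
  · intro h i hi
    cases i with
    | zero => exact koszulVanishes_zero_iff.mpr fun z hz => hreg (by simpa using hz y hy)
    | succ i => exact .succ_of_smul hy (fun _ => rfl) hinj hex hsurj (h i (by lia))

/-- A finite module over a Noetherian ring with `Hom(A/m, M) = 0` has a regular element in `m`. -/
lemma ExtVanishes.exists_isSMulRegular [IsNoetherianRing A] [Module.Finite A M] {m : Ideal A}
    (h : ExtVanishes m 0 M) : ∃ y ∈ m, IsSMulRegular M y := by
  have hsub : Subsingleton (A ⧸ m →ₗ[A] M) := by
    refine subsingleton_of_forall_eq 0 fun f => ?_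
    refine Submodule.linearMap_qext _ (LinearMap.ext_ring ?_)
    refine (extVanishes_zero_iff m).mp h _ fun y hy => ?_
    rw [← map_smul]
    have : (Submodule.mkQ m) y = 0 := (Submodule.Quotient.mk_eq_zero m).mpr hy
    simp only [LinearMap.comp_apply, smul_eq_mul, mul_one, this, map_zero]
  obtain ⟨y, hy, hreg⟩ := IsSMulRegular.subsingleton_linearMap_iff.mp hsub
  exact ⟨y, by rwa [Ideal.annihilator_quotient] at hy, hreg⟩

/-- Koszul cohomology detects depth. -/
lemma forall_extVanishes_iff_koszulVanishes [IsNoetherianRing A] {m : Ideal A}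
    (hm : m = Ideal.span {x | x ∈ l}) (r : ℕ) :
    ∀ (M : Type) [AddCommGroup M] [Module A M] [Module.Finite A M],
    (∀ i < r, ExtVanishes m i M) ↔ ∀ i < r, KoszulVanishes l (i : ℕ) M := by
  induction r with
  | zero => simp
  | succ r ih =>
    intro M _ _ _
    by_cases h : ExtVanishes m 0 M
    · obtain ⟨y, hy, hreg⟩ := h.exists_isSMulRegular
      rw [ExtVanishes.forall_lt_succ_iff hy hreg, ih,
        KoszulVanishes.forall_lt_succ_iff (hm ▸ hy) hreg]
    · refine iff_of_false (fun h' => h (h' 0 (by lia))) (fun h' => h ?_)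
      rw [extVanishes_zero_iff, hm]
      exact koszulVanishes_zero_iff.mp (h' 0 (by lia))

end KoszulVanishing

section Layer

variable {A : Type} [CommRing A]

/-- The quotient `K / L` of two ideals `L ≤ K`, as a module. -/
abbrev IdealLayer (K L : Ideal A) : Type := ↥K ⧸ Submodule.comap K.subtype L

/-- The inclusion of `K / L` into `A / L`. -/
def IdealLayer.incl (K L : Ideal A) : IdealLayer K L →ₗ[A] A ⧸ L :=
  Submodule.mapQ _ _ K.subtype le_rfl

lemma IdealLayer.incl_injective (K L : Ideal A) : Function.Injective (IdealLayer.incl K L) := by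
  rw [← LinearMap.ker_eq_bot, IdealLayer.incl, Submodule.mapQ, Submodule.ker_liftQ,
    LinearMap.ker_comp, Submodule.ker_mkQ, Submodule.mkQ_map_self]

lemma IdealLayer.exact (K L : Ideal A) (h : L ≤ K) :
    Function.Exact (IdealLayer.incl K L) (Submodule.factor h) := by
  intro z
  obtain ⟨z, rfl⟩ := Submodule.mkQ_surjective _ z
  constructor
  · intro hz
    have hz' : z ∈ K := (Submodule.Quotient.mk_eq_zero K).mp hz
    exact ⟨Submodule.Quotient.mk ⟨z, hz'⟩, rfl⟩
  · rintro ⟨w, hw⟩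
    obtain ⟨w, rfl⟩ := Submodule.mkQ_surjective _ w
    rw [← hw]
    exact (Submodule.Quotient.mk_eq_zero K).mpr w.2

lemma IdealLayer.forall_extVanishes {m K L : Ideal A} (hle : L ≤ K) {r : ℕ}
    (hL : ∀ i < r, ExtVanishes m i (A ⧸ L)) (hK : ∀ i < r, ExtVanishes m i (A ⧸ K)) :
    ∀ i < r, ExtVanishes m i (IdealLayer K L) :=
  ExtVanishes.left (IdealLayer.incl_injective _ _) (IdealLayer.exact _ _ hle)
    (Submodule.factor_surjective hle) hL fun i hi => hK i (by lia)

end Layer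

section Monomial

variable {n : ℕ} {k : Type} [Field k]

/-- Division by a variable, discarding the monomials it does not divide. -/
noncomputable def divVar (j : Fin n) : MvPolynomial (Fin n) k →+ MvPolynomial (Fin n) k where
  toFun p := p.divMonomial (Finsupp.single j 1)
  map_zero' := zero_divMonomial _
  map_add' p q := add_divMonomial p q _

/-- The substitution of zero for a variable. -/
noncomputable def killVar (j : Fin n) : MvPolynomial (Fin n) k →+ MvPolynomial (Fin n) k :=
  AddMonoidHom.id _ - (AddMonoidHom.mulLeft (X j)).comp (divVar j)

lemma killVar_apply (j : Fin n) (p : MvPolynomial (Fin n) k) :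
    killVar j p = p - X j * divVar j p := rfl

lemma divVar_X_mul (j : Fin n) (p : MvPolynomial (Fin n) k) : divVar j (X j * p) = p :=
  X_mul_divMonomial j p

lemma divVar_monomial_mul {j : Fin n} {e : Fin n →₀ ℕ} (he : e j = 0)
    (p : MvPolynomial (Fin n) k) :
    divVar j (monomial e 1 * p) = monomial e 1 * divVar j p := by
  ext s
  change coeff s ((monomial e 1 * p).divMonomial _) = coeff s (monomial e 1 * p.divMonomial _)
  rw [coeff_divMonomial, coeff_monomial_mul', coeff_monomial_mul', coeff_divMonomial]
  have h : e ≤ Finsupp.single j 1 + s ↔ e ≤ s := by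
    refine ⟨fun h i => ?_, fun h => h.trans le_add_self⟩
    by_cases hij : j = i
    · subst hij
      simp [he]
    · simpa [Finsupp.single_apply, hij] using h i
  by_cases hes : e ≤ s
  · rw [if_pos hes, if_pos (h.mpr hes), add_tsub_assoc_of_le hes]
  · rw [if_neg hes, if_neg (mt h.mp hes)]

lemma divVar_X_mul_of_ne {i j : Fin n} (h : j ≠ i) (p : MvPolynomial (Fin n) k) :
    divVar j (X i * p) = X i * divVar j p :=
  divVar_monomial_mul (by simp [h.symm]) p

lemma exists_monomial_eq_X_mul {j : Fin n} {e : Fin n →₀ ℕ} (he : e j ≠ 0) :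
    ∃ e', (monomial e (1 : k)) = X j * monomial e' 1 := by
  refine ⟨e - Finsupp.single j 1, ?_⟩
  rw [X, monomial_mul, one_mul, add_tsub_cancel_of_le]
  simpa [Finsupp.single_le_iff] using Nat.one_le_iff_ne_zero.mpr he

lemma killVar_X_mul (j : Fin n) (p : MvPolynomial (Fin n) k) : killVar j (X j * p) = 0 := by
  rw [killVar_apply, divVar_X_mul, sub_self]

lemma killVar_monomial_mul {j : Fin n} {e : Fin n →₀ ℕ} (he : e j = 0)
    (p : MvPolynomial (Fin n) k) :
    killVar j (monomial e 1 * p) = monomial e 1 * killVar j p := by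
  rw [killVar_apply, killVar_apply, divVar_monomial_mul he]
  ring

lemma killVar_X_mul_of_ne {i j : Fin n} (h : j ≠ i) (p : MvPolynomial (Fin n) k) :
    killVar j (X i * p) = X i * killVar j p :=
  killVar_monomial_mul (by simp [h.symm]) p

namespace IsMonomialIdeal

variable {J : Ideal (MvPolynomial (Fin n) k)}

lemma pow_induction (hJ : IsMonomialIdeal J) (t : ℕ)
    {K : Ideal (MvPolynomial (Fin n) k)}
    {f : MvPolynomial (Fin n) k →+ MvPolynomial (Fin n) k}
    (h : ∀ e, monomial e 1 ∈ J → ∀ p ∈ J ^ t, f (monomial e 1 * p) ∈ K) :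
    ∀ p ∈ J ^ (t + 1), f p ∈ K := by
  intro p hp
  obtain ⟨S, hS⟩ := hJ
  rw [pow_succ'] at hp
  induction hp using Submodule.mul_induction_on' with
  | add x _ y _ hx hy => rw [map_add]; exact add_mem hx hy
  | mem_mul_mem x hx y hy =>
    rw [hS] at hx
    induction hx using Submodule.span_induction generalizing y with
    | mem x hx =>
      obtain ⟨e, he, rfl⟩ := hx
      exact h e (hS ▸ Ideal.subset_span ⟨e, he, rfl⟩) y hy
    | zero => rw [zero_mul, map_zero]; exact zero_mem _
    | add a b _ _ ha hb => rw [add_mul, map_add]; exact add_mem (ha y hy) (hb y hy)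
    | smul c a _ ha =>
      rw [smul_mul_assoc, ← mul_smul_comm]
      exact ha _ (Ideal.mul_mem_left _ c hy)

lemma divVar_mem (hJ : IsMonomialIdeal J) (j : Fin n) (t : ℕ) :
    ∀ p ∈ J ^ (t + 1), divVar j p ∈ J ^ t := by
  induction t with
  | zero => simp
  | succ t ih =>
    refine hJ.pow_induction (t + 1) fun e he p hp => ?_
    by_cases hj : e j = 0
    · rw [divVar_monomial_mul hj, pow_succ']
      exact Ideal.mul_mem_mul he (ih p hp)
    · obtain ⟨e', he'⟩ := exists_monomial_eq_X_mul (k := k) hj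
      rw [he', mul_assoc, divVar_X_mul]
      exact Ideal.mul_mem_left _ _ hp

lemma killVar_mem (hJ : IsMonomialIdeal J) (j : Fin n) (t : ℕ) :
    ∀ p ∈ J ^ t, killVar j p ∈ J ^ t := by
  induction t with
  | zero => simp
  | succ t ih =>
    refine hJ.pow_induction t fun e he p hp => ?_
    by_cases hj : e j = 0
    · rw [killVar_monomial_mul hj, pow_succ']
      exact Ideal.mul_mem_mul he (ih p hp)
    · obtain ⟨e', he'⟩ := exists_monomial_eq_X_mul (k := k) hj
      rw [he', mul_assoc, killVar_X_mul]
      exact zero_mem _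

lemma le_span_X (hJ : IsMonomialIdeal J) (hJ1 : J ≠ ⊤) :
    J ≤ Ideal.span (Set.range X) := by
  obtain ⟨S, rfl⟩ := hJ
  refine Ideal.span_le.mpr ?_
  rintro _ ⟨e, he, rfl⟩
  by_cases h0 : e = 0
  · subst h0
    refine absurd ((Ideal.eq_top_iff_one _).mpr (Submodule.subset_span ?_)) hJ1
    exact ⟨0, he, rfl⟩
  · obtain ⟨j, hj⟩ := Finsupp.ne_iff.mp h0
    obtain ⟨e', he'⟩ := exists_monomial_eq_X_mul (k := k) hj
    change monomial e 1 ∈ Ideal.span _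
    rw [he']
    exact Ideal.mul_mem_right _ _ (Ideal.subset_span (Set.mem_range_self j))

end IsMonomialIdeal

lemma span_X_ne_top : Ideal.span (Set.range (X : Fin n → MvPolynomial (Fin n) k)) ≠ ⊤ := by
  intro h
  have h1 : Ideal.span (Set.range (X : Fin n → MvPolynomial (Fin n) k)) ≤
      RingHom.ker (constantCoeff : MvPolynomial (Fin n) k →+* k) := by
    refine Ideal.span_le.mpr ?_
    rintro _ ⟨j, rfl⟩
    simp [RingHom.mem_ker]
  exact RingHom.ker_ne_top _ (top_le_iff.mp (h ▸ h1))

variable (n k) in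
/-- The list of the variables of `k[x_1, …, x_n]`. -/
noncomputable def varList : List (MvPolynomial (Fin n) k) := (List.finRange n).map X

lemma mem_varList {p : MvPolynomial (Fin n) k} : p ∈ varList n k ↔ ∃ j, X j = p := by
  simp [varList]

lemma span_range_X_eq :
    Ideal.span (Set.range (X : Fin n → MvPolynomial (Fin n) k)) =
      Ideal.span {x | x ∈ varList n k} := by
  congr 1
  ext p
  exact mem_varList.symm

lemma length_varList : (varList n k).length = n := by simp [varList]

lemma nodup_varList : (varList n k).Nodup :=
  (List.nodup_finRange n).map X_injective

/-- The additive map between quotients by ideals induced by an additive map. -/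
def Ideal.quotientAddMap {A : Type} [CommRing A] (K L : Ideal A) (f : A →+ A)
    (h : ∀ x ∈ K, f x ∈ L) : A ⧸ K →+ A ⧸ L :=
  QuotientAddGroup.map K.toAddSubgroup L.toAddSubgroup f h

lemma exists_d_eq_factor {J : Ideal (MvPolynomial (Fin n) k)} (hJ : IsMonomialIdeal J) (t : ℕ)
    {i : ℤ} (hi : i < n) (z : Koszul (MvPolynomial (Fin n) k ⧸ J ^ (t + 1)) (varList n k))
    (hz : z ∈ Koszul.deg _ _ i) (hd : Koszul.d _ _ z = 0) :
    ∃ w ∈ Koszul.deg _ _ (i - 1), Koszul.d _ _ w = Koszul.map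
      (Submodule.factor (Ideal.pow_le_pow_right (I := J) t.le_succ)).toAddMonoidHom _ z := by
  classical
  let D (j : Fin n) := Ideal.quotientAddMap _ _ (divVar j) (hJ.divVar_mem j t)
  let π (j : Fin n) := Ideal.quotientAddMap _ _ (killVar j) (hJ.killVar_mem j (t + 1))
  have hX : Function.Injective (X : Fin n → MvPolynomial (Fin n) k) := X_injective
  refine Koszul.exists_d_eq_map _ (Function.extend X D 0) (Function.extend X π 0)
    (varList n k) nodup_varList ?_ ?_ ?_ ?_ ?_ i (by rwa [length_varList]) z hz hd
  · rintro x hx z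
    obtain ⟨j, rfl⟩ := mem_varList.mp hx
    obtain ⟨z, rfl⟩ := Ideal.Quotient.mk_surjective z
    rw [hX.extend_apply]
    change Ideal.Quotient.mk _ (divVar j (X j * z)) = Ideal.Quotient.mk _ z
    rw [divVar_X_mul]
  · rintro x hx z
    obtain ⟨j, rfl⟩ := mem_varList.mp hx
    obtain ⟨z, rfl⟩ := Ideal.Quotient.mk_surjective z
    rw [hX.extend_apply, hX.extend_apply]
    change Ideal.Quotient.mk _ (X j * divVar j z) =
      Ideal.Quotient.mk _ z - Ideal.Quotient.mk _ (killVar j z)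
    rw [← map_sub, killVar_apply, sub_sub_cancel]
  · rintro x hx y hy hxy z
    obtain ⟨j, rfl⟩ := mem_varList.mp hx
    obtain ⟨i, rfl⟩ := mem_varList.mp hy
    obtain ⟨z, rfl⟩ := Ideal.Quotient.mk_surjective z
    rw [hX.extend_apply]
    change Ideal.Quotient.mk _ (divVar j (X i * z)) = Ideal.Quotient.mk _ (X i * divVar j z)
    rw [divVar_X_mul_of_ne (fun h => hxy (congrArg X h))]
  · rintro x hx y hy hxy z
    obtain ⟨j, rfl⟩ := mem_varList.mp hx
    obtain ⟨i, rfl⟩ := mem_varList.mp hy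
    obtain ⟨z, rfl⟩ := Ideal.Quotient.mk_surjective z
    rw [hX.extend_apply]
    change Ideal.Quotient.mk _ (killVar j (X i * z)) = Ideal.Quotient.mk _ (X i * killVar j z)
    rw [killVar_X_mul_of_ne (fun h => hxy (congrArg X h))]
  · rintro x hx z
    obtain ⟨j, rfl⟩ := mem_varList.mp hx
    obtain ⟨z, rfl⟩ := Ideal.Quotient.mk_surjective z
    rw [hX.extend_apply]
    change Ideal.Quotient.mk _ (killVar j (X j * z)) = 0
    rw [killVar_X_mul, map_zero]

lemma not_koszulVanishes_top_layer {J : Ideal (MvPolynomial (Fin n) k)} (hJ : IsMonomialIdeal J)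
    (hJ0 : J ≠ ⊥) (hJ1 : J ≠ ⊤) (t : ℕ) :
    ¬ KoszulVanishes (varList n k) n (IdealLayer (J ^ t) (J ^ (t + 1))) := by
  intro h
  set m : Ideal (MvPolynomial (Fin n) k) := Ideal.span (Set.range X) with hm
  have hle : J ^ t ≤ m • J ^ t := by
    intro x hx
    let u : IdealLayer (J ^ t) (J ^ (t + 1)) := Submodule.mkQ _ ⟨x, hx⟩
    obtain ⟨w, hw, hwu⟩ := h (Koszul.top _ u)
      (by simpa only [length_varList] using Koszul.top_mem_deg (varList n k) u)
      (Koszul.d_top _ u)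
    have hu := Koszul.mem_smul_top_of_d_eq_top _ u w (by simpa only [length_varList] using hw) hwu
    rw [← span_range_X_eq, ← hm, ← Submodule.range_mkQ, LinearMap.range_eq_map,
      ← Submodule.map_smul''] at hu
    obtain ⟨y, hy, hyu⟩ := hu
    have h1 : (y : MvPolynomial (Fin n) k) ∈ m • J ^ t := by
      have := Submodule.mem_map_of_mem (f := (J ^ t).subtype) hy
      rwa [Submodule.map_smul'', Submodule.map_subtype_top] at this
    have h2 : (y : MvPolynomial (Fin n) k) - x ∈ J ^ (t + 1) :=
      (Submodule.Quotient.eq (Submodule.comap (J ^ t).subtype (J ^ (t + 1)))).mp hyu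
    have h3 : J ^ (t + 1) ≤ m • J ^ t := by
      rw [pow_succ', smul_eq_mul]
      exact Ideal.mul_mono_left (hJ.le_span_X hJ1)
    have h4 := Submodule.sub_mem _ h1 (h3 h2)
    rwa [sub_sub_cancel] at h4
  obtain ⟨r, hr, hr0⟩ := Submodule.exists_sub_one_mem_and_smul_eq_zero_of_fg_of_le_smul m (J ^ t)
    (IsNoetherian.noetherian _) hle
  obtain ⟨x, hx, hx0⟩ := Submodule.exists_mem_ne_zero_of_ne_bot (pow_ne_zero t hJ0)
  obtain rfl : r = 0 := (mul_eq_zero.mp (hr0 x hx)).resolve_right hx0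
  refine span_X_ne_top (k := k) (n := n) ((Ideal.eq_top_iff_one _).mpr ?_)
  simpa using hr

/-- If the Koszul cohomology of a layer `J^t / J^(t+1)` vanishes in some degree, then so does that
of `k[x_1, …, x_n] / J^(t+1)`. -/
lemma koszulVanishes_of_layer {J : Ideal (MvPolynomial (Fin n) k)} (hJ : IsMonomialIdeal J)
    (hJ0 : J ≠ ⊥) (hJ1 : J ≠ ⊤) (t : ℕ) {i : ℤ}
    (h : KoszulVanishes (varList n k) i (IdealLayer (J ^ t) (J ^ (t + 1)))) :
    KoszulVanishes (varList n k) i (MvPolynomial (Fin n) k ⧸ J ^ (t + 1)) := by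
  have hle : J ^ (t + 1) ≤ J ^ t := Ideal.pow_le_pow_right t.le_succ
  intro z hz hd
  rcases lt_trichotomy i n with hi | rfl | hi
  · obtain ⟨w, hw, hwz⟩ := exists_d_eq_factor hJ t hi z hz hd
    obtain ⟨w, hw', rfl⟩ := Koszul.exists_map_eq_of_surjective
      (f := (Submodule.factor hle).toAddMonoidHom) (Submodule.factor_surjective hle) _ _ w hw
    rw [← Koszul.map_d_of_linear] at hwz
    have hdw := Koszul.d_mem_deg _ _ w hw'
    rw [sub_add_cancel] at hdw
    obtain ⟨u, hu, huz⟩ := Koszul.exists_map_eq_of_exact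
      (f := (IdealLayer.incl (J ^ t) (J ^ (t + 1))).toAddMonoidHom)
      (g := (Submodule.factor hle).toAddMonoidHom) (IdealLayer.exact _ _ hle) _ i
      (z - Koszul.d _ _ w) (Submodule.sub_mem _ hz hdw)
      (by rw [map_sub, hwz, sub_self])
    obtain ⟨v, hv, rfl⟩ := h u hu (Koszul.map_injective
      (f := (IdealLayer.incl (J ^ t) (J ^ (t + 1))).toAddMonoidHom)
      (IdealLayer.incl_injective _ _) _ (by
        rw [Koszul.map_d_of_linear, huz, map_sub, hd, Koszul.d_d, sub_zero, map_zero]))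
    refine ⟨Koszul.map (IdealLayer.incl (J ^ t) (J ^ (t + 1))).toAddMonoidHom _ v + w,
      Submodule.add_mem _ (Koszul.map_mem_deg _ _ _ v hv) hw', ?_⟩
    rw [map_add, ← Koszul.map_d_of_linear, huz, sub_add_cancel]
  · exact absurd h (not_koszulVanishes_top_layer hJ hJ0 hJ1 t)
  · refine ⟨0, Submodule.zero_mem _, ?_⟩
    rw [Koszul.deg_gt _ i (by rwa [length_varList]) z hz, map_zero]

/-- The first non-vanishing of `Ext` for `k[x_1, …, x_n] / J^(t+1)` is inherited by
`J^t / J^(t+1)`. -/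
lemma not_extVanishes_layer {J : Ideal (MvPolynomial (Fin n) k)} (hJ : IsMonomialIdeal J)
    (hJ0 : J ≠ ⊥) (hJ1 : J ≠ ⊤) (t : ℕ) {r : ℕ} {m : Ideal (MvPolynomial (Fin n) k)}
    (hm : m = Ideal.span (Set.range X))
    (h : ∀ i < r, ExtVanishes m i (MvPolynomial (Fin n) k ⧸ J ^ (t + 1)))
    (hr : ¬ ExtVanishes m r (MvPolynomial (Fin n) k ⧸ J ^ (t + 1)))
    (h' : ∀ i < r, ExtVanishes m i (MvPolynomial (Fin n) k ⧸ J ^ t)) :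
    ¬ ExtVanishes m r (IdealLayer (J ^ t) (J ^ (t + 1))) := by
  rw [span_range_X_eq] at hm
  intro hL
  have h1 := (forall_extVanishes_iff_koszulVanishes hm (r + 1) _).mp
    (Nat.forall_lt_succ_right.mpr ⟨IdealLayer.forall_extVanishes
      (Ideal.pow_le_pow_right t.le_succ) h h', hL⟩)
  refine hr ((forall_extVanishes_iff_koszulVanishes hm (r + 1) _).mpr ?_ r (by lia))
  exact fun i hi => koszulVanishes_of_layer hJ hJ0 hJ1 t (h1 i hi)

end Monomial

section BoxTensor

variable (k : Type) [Field k]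

/-- The tensor product over `k` of an `R`-module and an `S`-module, as an `R ⊗[k] S`-module. -/
def BoxTensor (M N : Type) [AddCommGroup M] [Module k M] [AddCommGroup N] [Module k N] : Type :=
  M ⊗[k] N

noncomputable instance BoxTensor.instAddCommGroup (M N : Type) [AddCommGroup M] [Module k M]
    [AddCommGroup N] [Module k N] : AddCommGroup (BoxTensor k M N) :=
  inferInstanceAs (AddCommGroup (M ⊗[k] N))

variable {k} {R S : Type} [CommRing R] [CommRing S] [Algebra k R] [Algebra k S]

noncomputable instance BoxTensor.instModule (M N : Type) [AddCommGroup M] [Module k M]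
    [Module R M] [IsScalarTower k R M] [AddCommGroup N] [Module k N] [Module S N]
    [IsScalarTower k S N] : Module (R ⊗[k] S) (BoxTensor k M N) :=
  Module.compHom (M ⊗[k] N)
    (((Module.endTensorEndAlgHom (R := k) (S := k) (A := k) (M := M) (N := N)).comp
      (Algebra.TensorProduct.map (Algebra.lsmul k k M) (Algebra.lsmul k k N)) :
        R ⊗[k] S →ₐ[k] Module.End k (M ⊗[k] N)) : R ⊗[k] S →+* Module.End k (M ⊗[k] N))

namespace BoxTensor

variable {M N : Type} [AddCommGroup M] [Module k M] [Module R M] [IsScalarTower k R M]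
  [AddCommGroup N] [Module k N] [Module S N] [IsScalarTower k S N]

/-- A pure tensor. -/
def tmul (m : M) (n : N) : BoxTensor k M N := m ⊗ₜ[k] n

omit [Module R M] [IsScalarTower k R M] [Module S N] [IsScalarTower k S N] in
@[elab_as_elim]
lemma induction {p : BoxTensor k M N → Prop} (z : BoxTensor k M N) (zero : p 0)
    (tmul : ∀ m n, p (tmul m n)) (add : ∀ x y, p x → p y → p (x + y)) : p z :=
  TensorProduct.induction_on z zero tmul add

lemma tmul_smul_tmul (r : R) (s : S) (m : M) (n : N) :
    (r ⊗ₜ[k] s) • (tmul m n : BoxTensor k M N) = tmul (r • m) (s • n) := rfl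

/-- The additive map underlying `BoxTensor.map`. -/
noncomputable def mapAddHom {M' N' : Type} [AddCommGroup M'] [Module k M'] [Module R M']
    [IsScalarTower k R M'] [AddCommGroup N'] [Module k N'] [Module S N'] [IsScalarTower k S N']
    (f : M →ₗ[R] M') (g : N →ₗ[S] N') : BoxTensor k M N →+ BoxTensor k M' N' :=
  (TensorProduct.map (f.restrictScalars k) (g.restrictScalars k)).toAddMonoidHom

/-- The `R ⊗[k] S`-linear map induced by an `R`-linear map and an `S`-linear map. -/
noncomputable def map {M' N' : Type} [AddCommGroup M'] [Module k M'] [Module R M']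
    [IsScalarTower k R M'] [AddCommGroup N'] [Module k N'] [Module S N'] [IsScalarTower k S N']
    (f : M →ₗ[R] M') (g : N →ₗ[S] N') : BoxTensor k M N →ₗ[R ⊗[k] S] BoxTensor k M' N' where
  toFun := mapAddHom f g
  map_add' := map_add _
  map_smul' x z := by
    rw [RingHom.id_apply]
    induction x using TensorProduct.induction_on with
    | zero => rw [zero_smul, zero_smul, map_zero]
    | add x y hx hy => rw [add_smul, add_smul, map_add, hx, hy]
    | tmul r s =>
      induction z using BoxTensor.induction with
      | zero => rw [smul_zero, map_zero, smul_zero]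
      | add x y hx hy => rw [smul_add, map_add, map_add, smul_add, hx, hy]
      | tmul m n =>
        change f (r • m) ⊗ₜ[k] g (s • n) = (r • f m) ⊗ₜ[k] (s • g n)
        rw [map_smul, map_smul]

lemma map_tmul {M' N' : Type} [AddCommGroup M'] [Module k M'] [Module R M']
    [IsScalarTower k R M'] [AddCommGroup N'] [Module k N'] [Module S N'] [IsScalarTower k S N']
    (f : M →ₗ[R] M') (g : N →ₗ[S] N') (m : M) (n : N) :
    map f g (tmul m n : BoxTensor k M N) = tmul (f m) (g n) := rfl

section Left

variable {M₁ M₂ M₃ : Type} [AddCommGroup M₁] [Module k M₁] [Module R M₁] [IsScalarTower k R M₁]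
  [AddCommGroup M₂] [Module k M₂] [Module R M₂] [IsScalarTower k R M₂]
  [AddCommGroup M₃] [Module k M₃] [Module R M₃] [IsScalarTower k R M₃]

variable (N) in
lemma map_id_injective {f : M₁ →ₗ[R] M₂} (hf : Function.Injective f) :
    Function.Injective (map (k := k) f (LinearMap.id : N →ₗ[S] N)) :=
  Module.Flat.rTensor_preserves_injective_linearMap (M := N) (f.restrictScalars k) hf

variable (N) in
lemma map_id_exact {f : M₁ →ₗ[R] M₂} {g : M₂ →ₗ[R] M₃} (hfg : Function.Exact f g)
    (hg : Function.Surjective g) :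
    Function.Exact (map (k := k) f (LinearMap.id : N →ₗ[S] N))
      (map (k := k) g (LinearMap.id : N →ₗ[S] N)) :=
  rTensor_exact N (f := f.restrictScalars k) (g := g.restrictScalars k) hfg hg

variable (N) in
lemma map_id_surjective {g : M₂ →ₗ[R] M₃} (hg : Function.Surjective g) :
    Function.Surjective (map (k := k) g (LinearMap.id : N →ₗ[S] N)) :=
  LinearMap.rTensor_surjective N (g := g.restrictScalars k) hg

end Left

section Right

variable {N₁ N₂ N₃ : Type} [AddCommGroup N₁] [Module k N₁] [Module S N₁] [IsScalarTower k S N₁]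
  [AddCommGroup N₂] [Module k N₂] [Module S N₂] [IsScalarTower k S N₂]
  [AddCommGroup N₃] [Module k N₃] [Module S N₃] [IsScalarTower k S N₃]

variable (M) in
lemma id_map_injective {f : N₁ →ₗ[S] N₂} (hf : Function.Injective f) :
    Function.Injective (map (k := k) (LinearMap.id : M →ₗ[R] M) f) :=
  Module.Flat.lTensor_preserves_injective_linearMap (M := M) (f.restrictScalars k) hf

variable (M) in
lemma id_map_exact {f : N₁ →ₗ[S] N₂} {g : N₂ →ₗ[S] N₃} (hfg : Function.Exact f g)
    (hg : Function.Surjective g) :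
    Function.Exact (map (k := k) (LinearMap.id : M →ₗ[R] M) f)
      (map (k := k) (LinearMap.id : M →ₗ[R] M) g) :=
  lTensor_exact M (f := f.restrictScalars k) (g := g.restrictScalars k) hfg hg

variable (M) in
lemma id_map_surjective {g : N₂ →ₗ[S] N₃} (hg : Function.Surjective g) :
    Function.Surjective (map (k := k) (LinearMap.id : M →ₗ[R] M) g) :=
  LinearMap.lTensor_surjective M (g := g.restrictScalars k) hg

end Right

lemma tmul_ne_zero {m : M} {n : N} (hm : m ≠ 0) (hn : n ≠ 0) :
    (tmul m n : BoxTensor k M N) ≠ 0 := by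
  intro h
  obtain ⟨φ, hφ⟩ := not_forall.mp (mt (Module.forall_dual_apply_eq_zero_iff k m).mp hm)
  obtain ⟨ψ, hψ⟩ := not_forall.mp (mt (Module.forall_dual_apply_eq_zero_iff k n).mp hn)
  have := congrArg (TensorProduct.map φ ψ) (show m ⊗ₜ[k] n = 0 from h)
  rw [map_zero, TensorProduct.map_tmul] at this
  have := congrArg (TensorProduct.lid k k) this
  simp [hφ, hψ] at this

variable {mR : Ideal R} {mS : Ideal S} {mT : Ideal (R ⊗[k] S)}

lemma extVanishes_zero_imp
    (hmT : mT = mR.map (algebraMap R (R ⊗[k] S)) +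
      mS.map ((Algebra.TensorProduct.includeRight : S →ₐ[k] R ⊗[k] S) : S →+* R ⊗[k] S))
    (h : ExtVanishes mT 0 (BoxTensor k M N)) : ExtVanishes mR 0 M ∨ ExtVanishes mS 0 N := by
  by_contra! hc
  simp only [extVanishes_zero_iff, not_forall] at h hc
  obtain ⟨⟨u, hu, hu0⟩, ⟨v, hv, hv0⟩⟩ := hc
  refine tmul_ne_zero (k := k) hu0 hv0 (h _ ?_)
  have hle : mT ≤ LinearMap.ker (LinearMap.toSpanSingleton (R ⊗[k] S) _
      (tmul u v : BoxTensor k M N)) := by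
    rw [hmT]
    refine sup_le (Ideal.map_le_iff_le_comap.mpr fun y hy => ?_)
      (Ideal.map_le_iff_le_comap.mpr fun y hy => ?_)
    · change (y ⊗ₜ[k] (1 : S)) • (tmul u v : BoxTensor k M N) = 0
      rw [tmul_smul_tmul, hu y hy]
      exact TensorProduct.zero_tmul _ _
    · change ((1 : R) ⊗ₜ[k] y) • (tmul u v : BoxTensor k M N) = 0
      rw [tmul_smul_tmul, hv y hy]
      exact TensorProduct.tmul_zero _ _
  exact fun y hy => hle hy

lemma forall_lt_succ_iff_left
    (hmT : mT = mR.map (algebraMap R (R ⊗[k] S)) +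
      mS.map ((Algebra.TensorProduct.includeRight : S →ₐ[k] R ⊗[k] S) : S →+* R ⊗[k] S))
    {y : R} (hy : y ∈ mR) (hreg : IsSMulRegular M y) (r : ℕ) :
    (∀ i < r + 1, ExtVanishes mT i (BoxTensor k M N)) ↔
      ∀ i < r, ExtVanishes mT i (BoxTensor k (QuotSMulTop y M) N) := by
  have hsurj := Submodule.mkQ_surjective (y • (⊤ : Submodule R M))
  refine ExtVanishes.forall_lt_succ_iff_of_exact (y := y ⊗ₜ[k] (1 : S)) ?_ (fun z => ?_)
    (map_id_injective N (f := LinearMap.lsmul R M y) hreg)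
    (map_id_exact N (exact_smul_mkQ M y) hsurj) (map_id_surjective N hsurj) r
  · rw [hmT]
    exact Ideal.mem_sup_left (Ideal.mem_map_of_mem (algebraMap R (R ⊗[k] S)) hy)
  · induction z using BoxTensor.induction with
    | zero => rw [map_zero, smul_zero]
    | add x y hx hy => rw [map_add, smul_add, hx, hy]
    | tmul m n => rw [map_tmul, tmul_smul_tmul, one_smul]; rfl

lemma forall_lt_succ_iff_right
    (hmT : mT = mR.map (algebraMap R (R ⊗[k] S)) +
      mS.map ((Algebra.TensorProduct.includeRight : S →ₐ[k] R ⊗[k] S) : S →+* R ⊗[k] S))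
    {y : S} (hy : y ∈ mS) (hreg : IsSMulRegular N y) (r : ℕ) :
    (∀ i < r + 1, ExtVanishes mT i (BoxTensor k M N)) ↔
      ∀ i < r, ExtVanishes mT i (BoxTensor k M (QuotSMulTop y N)) := by
  have hsurj := Submodule.mkQ_surjective (y • (⊤ : Submodule S N))
  refine ExtVanishes.forall_lt_succ_iff_of_exact (y := (1 : R) ⊗ₜ[k] y) ?_ (fun z => ?_)
    (id_map_injective M (f := LinearMap.lsmul S N y) hreg)
    (id_map_exact M (exact_smul_mkQ N y) hsurj) (id_map_surjective M hsurj) r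
  · rw [hmT]
    exact Ideal.mem_sup_right (Ideal.mem_map_of_mem
      ((Algebra.TensorProduct.includeRight : S →ₐ[k] R ⊗[k] S) : S →+* R ⊗[k] S) hy)
  · induction z using BoxTensor.induction with
    | zero => rw [map_zero, smul_zero]
    | add x y hx hy => rw [map_add, smul_add, hx, hy]
    | tmul m n => rw [map_tmul, tmul_smul_tmul, one_smul]; rfl

/-- Depth is additive for tensor products over a field. -/
lemma forall_extVanishes [IsNoetherianRing R] [IsNoetherianRing S]
    (hmT : mT = mR.map (algebraMap R (R ⊗[k] S)) +
      mS.map ((Algebra.TensorProduct.includeRight : S →ₐ[k] R ⊗[k] S) : S →+* R ⊗[k] S))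
    (p q : ℕ) :
    ∀ (M N : Type) [AddCommGroup M] [Module k M] [Module R M] [IsScalarTower k R M]
      [AddCommGroup N] [Module k N] [Module S N] [IsScalarTower k S N]
      [Module.Finite R M] [Module.Finite S N],
    (∀ i < p, ExtVanishes mR i M) → (∀ i < q, ExtVanishes mS i N) →
      (∀ i < p + q, ExtVanishes mT i (BoxTensor k M N)) ∧
      ((∀ i < p + q + 1, ExtVanishes mT i (BoxTensor k M N)) →
        ExtVanishes mR p M ∨ ExtVanishes mS q N) := by
  induction p with
  | zero =>
    induction q with
    | zero =>
      intro M N _ _ _ _ _ _ _ _ _ _ _ _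
      exact ⟨fun i hi => absurd hi (by lia), fun h => extVanishes_zero_imp hmT (h 0 (by lia))⟩
    | succ q ih =>
      intro M N _ _ _ _ _ _ _ _ _ _ hM hN
      obtain ⟨y, hy, hreg⟩ := (hN 0 (by lia)).exists_isSMulRegular
      have hN' := (ExtVanishes.forall_lt_succ_iff hy hreg q).mp hN
      obtain ⟨h₁, h₂⟩ := ih M (QuotSMulTop y N) hM hN'
      refine ⟨(forall_lt_succ_iff_right hmT hy hreg _).mpr h₁, fun h => ?_⟩
      refine (h₂ ((forall_lt_succ_iff_right hmT hy hreg _).mp h)).imp_right fun h => ?_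
      exact (ExtVanishes.forall_lt_succ_iff hy hreg (q + 1)).mpr
        (Nat.forall_lt_succ_right.mpr ⟨hN', h⟩) _ (by lia)
  | succ p ih =>
    intro M N _ _ _ _ _ _ _ _ _ _ hM hN
    obtain ⟨y, hy, hreg⟩ := (hM 0 (by lia)).exists_isSMulRegular
    have hM' := (ExtVanishes.forall_lt_succ_iff hy hreg p).mp hM
    obtain ⟨h₁, h₂⟩ := ih (QuotSMulTop y M) N hM' hN
    rw [Nat.add_right_comm]
    refine ⟨(forall_lt_succ_iff_left hmT hy hreg _).mpr h₁, fun h => ?_⟩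
    refine (h₂ ((forall_lt_succ_iff_left hmT hy hreg _).mp h)).imp_left fun h => ?_
    exact (ExtVanishes.forall_lt_succ_iff hy hreg (p + 1)).mpr
      (Nat.forall_lt_succ_right.mpr ⟨hM', h⟩) _ (by lia)

end BoxTensor

end BoxTensor

namespace BoxTensor

variable {k R S : Type} [Field k] [CommRing R] [CommRing S] [Algebra k R] [Algebra k S]

section Ext

variable {M N X : Type} [AddCommGroup M] [Module k M] [Module R M] [IsScalarTower k R M]
  [AddCommGroup N] [Module k N] [Module S N] [IsScalarTower k S N]
  [AddCommGroup X] [Module (R ⊗[k] S) X]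

lemma hom_ext {f g : BoxTensor k M N →ₗ[R ⊗[k] S] X} (h : ∀ m n, f (tmul m n) = g (tmul m n)) :
    f = g := by
  ext z
  induction z using BoxTensor.induction with
  | zero => rw [map_zero, map_zero]
  | add x y hx hy => rw [map_add, map_add, hx, hy]
  | tmul m n => exact h m n

end Ext

variable (k R S) in
/-- The additive map underlying `BoxTensor.toTensor`. -/
noncomputable def toTensorAddHom : BoxTensor k R S →+ R ⊗[k] S := AddMonoidHom.id (R ⊗[k] S)

variable (k R S) in
/-- The canonical identification with the tensor product algebra. -/
noncomputable def toTensor : BoxTensor k R S →ₗ[R ⊗[k] S] R ⊗[k] S where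
  toFun := toTensorAddHom k R S
  map_add' := map_add _
  map_smul' x z := by
    rw [RingHom.id_apply]
    induction x using TensorProduct.induction_on with
    | zero => rw [zero_smul, zero_smul, map_zero]
    | add x y hx hy => rw [add_smul, add_smul, map_add, hx, hy]
    | tmul r s =>
      induction z using BoxTensor.induction with
      | zero => rw [smul_zero, map_zero, smul_zero]
      | add x y hx hy => rw [smul_add, map_add, map_add, smul_add, hx, hy]
      | tmul m n => exact (Algebra.TensorProduct.tmul_mul_tmul r m s n).symm

/-- The kernel of a tensor product of two surjections. -/
lemma exists_of_map_eq_zero {M₁ M₂ M₃ N₁ N₂ N₃ : Type}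
    [AddCommGroup M₁] [Module k M₁] [Module R M₁] [IsScalarTower k R M₁]
    [AddCommGroup M₂] [Module k M₂] [Module R M₂] [IsScalarTower k R M₂]
    [AddCommGroup M₃] [Module k M₃] [Module R M₃] [IsScalarTower k R M₃]
    [AddCommGroup N₁] [Module k N₁] [Module S N₁] [IsScalarTower k S N₁]
    [AddCommGroup N₂] [Module k N₂] [Module S N₂] [IsScalarTower k S N₂]
    [AddCommGroup N₃] [Module k N₃] [Module S N₃] [IsScalarTower k S N₃]
    {f : M₁ →ₗ[R] M₂} {g : M₂ →ₗ[R] M₃} (hfg : Function.Exact f g) (hg : Function.Surjective g)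
    {f' : N₁ →ₗ[S] N₂} {g' : N₂ →ₗ[S] N₃} (hfg' : Function.Exact f' g')
    (hg' : Function.Surjective g') (z : BoxTensor k M₂ N₂) (hz : map g g' z = 0) :
    ∃ (u : BoxTensor k M₁ N₂) (v : BoxTensor k M₂ N₁),
      map f (LinearMap.id : N₂ →ₗ[S] N₂) u + map (LinearMap.id : M₂ →ₗ[R] M₂) f' v = z := by
  have hc : map g g' = (map g (LinearMap.id : N₃ →ₗ[S] N₃)).comp
      (map (k := k) (LinearMap.id : M₂ →ₗ[R] M₂) g') := hom_ext fun _ _ => rfl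
  rw [hc, LinearMap.comp_apply] at hz
  obtain ⟨w, hw⟩ := (map_id_exact N₃ hfg hg _).mp hz
  obtain ⟨u, rfl⟩ := id_map_surjective (R := R) M₁ hg' w
  have hc' : (map f (LinearMap.id : N₃ →ₗ[S] N₃)).comp (map (k := k) (LinearMap.id : M₁ →ₗ[R] M₁) g') =
      (map (k := k) (LinearMap.id : M₂ →ₗ[R] M₂) g').comp (map f (LinearMap.id : N₂ →ₗ[S] N₂)) :=
    hom_ext fun _ _ => rfl
  have hw' := LinearMap.congr_fun hc' u
  rw [LinearMap.comp_apply, LinearMap.comp_apply, hw] at hw'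
  obtain ⟨v, hv⟩ := (id_map_exact M₂ hfg' hg' (z - map f (LinearMap.id : N₂ →ₗ[S] N₂) u)).mp
    (by rw [map_sub, hw', sub_self])
  exact ⟨u, v, by rw [hv, add_sub_cancel]⟩

section Layer

variable {K : Ideal R} {L L' : Ideal S} {Q : Ideal (R ⊗[k] S)}

open Algebra.TensorProduct (includeRight)

local notation "extL" => Ideal.map (algebraMap R (R ⊗[k] S))

local notation "extR" => Ideal.map ((includeRight : S →ₐ[k] R ⊗[k] S) : S →+* R ⊗[k] S)

/-- The map `R ⊗ L → (R ⊗ S) / Q`. -/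
noncomputable def layerLift (L : Ideal S) (Q : Ideal (R ⊗[k] S)) :
    BoxTensor k R L →ₗ[R ⊗[k] S] (R ⊗[k] S) ⧸ Q :=
  (Submodule.mkQ Q).comp ((toTensor k R S).comp (map LinearMap.id L.subtype))

lemma layerLift_eq_zero (h₁ : extL K * extR L ≤ Q) (h₂ : extR L' ≤ Q) (z : BoxTensor k R L)
    (hz : map (Submodule.mkQ K) (Submodule.mkQ (Submodule.comap L.subtype L')) z = 0) :
    layerLift L Q z = 0 := by
  obtain ⟨u, v, rfl⟩ := exists_of_map_eq_zero (f := K.subtype)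
    (f' := (Submodule.comap L.subtype L').subtype)
    (by rw [LinearMap.exact_iff, Submodule.ker_mkQ, Submodule.range_subtype])
    (Submodule.mkQ_surjective _)
    (by rw [LinearMap.exact_iff, Submodule.ker_mkQ, Submodule.range_subtype])
    (Submodule.mkQ_surjective _) z hz
  have hu : (layerLift L Q).comp (map (k := k) K.subtype LinearMap.id) = 0 := by
    refine hom_ext fun x l => (Submodule.Quotient.mk_eq_zero Q).mpr (h₁ ?_)
    have : ((x : R) ⊗ₜ[k] ((l : L) : S)) = (x : R) ⊗ₜ[k] 1 * 1 ⊗ₜ[k] (l : S) := by simp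
    change ((x : R) ⊗ₜ[k] ((l : L) : S)) ∈ _
    rw [this]
    exact Ideal.mul_mem_mul (Ideal.mem_map_of_mem (algebraMap R (R ⊗[k] S)) x.2)
      (Ideal.mem_map_of_mem
        ((Algebra.TensorProduct.includeRight : S →ₐ[k] R ⊗[k] S) : S →+* R ⊗[k] S) l.2)
  have hv : (layerLift L Q).comp
      (map (k := k) LinearMap.id (Submodule.comap L.subtype L').subtype) = 0 := by
    refine hom_ext fun x l => (Submodule.Quotient.mk_eq_zero Q).mpr (h₂ ?_)
    have : ((x : R) ⊗ₜ[k] ((l : L) : S)) = (x : R) ⊗ₜ[k] 1 * 1 ⊗ₜ[k] ((l : L) : S) := by simp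
    change ((x : R) ⊗ₜ[k] ((l : L) : S)) ∈ _
    rw [this]
    exact Ideal.mul_mem_left _ _ (Ideal.mem_map_of_mem
      ((Algebra.TensorProduct.includeRight : S →ₐ[k] R ⊗[k] S) : S →+* R ⊗[k] S) l.2)
  rw [map_add, ← LinearMap.comp_apply, ← LinearMap.comp_apply, hu, hv, LinearMap.zero_apply,
    LinearMap.zero_apply, add_zero]

/-- The map `(R ⊗ S) / Q → R / K ⊗ S / L'`. -/
noncomputable def quotientToBox (h₃ : Q ≤ extL K ⊔ extR L') :
    ((R ⊗[k] S) ⧸ Q) →ₗ[R ⊗[k] S] BoxTensor k (R ⧸ K) (S ⧸ L') :=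
  Submodule.liftQ Q (LinearMap.toSpanSingleton (R ⊗[k] S) (BoxTensor k (R ⧸ K) (S ⧸ L'))
      (tmul (Submodule.mkQ K 1) (Submodule.mkQ L' 1))) (by
    refine h₃.trans (sup_le (Ideal.map_le_iff_le_comap.mpr fun y hy => ?_)
      (Ideal.map_le_iff_le_comap.mpr fun y hy => ?_))
    · change (y ⊗ₜ[k] (1 : S)) • (tmul _ _ : BoxTensor k (R ⧸ K) (S ⧸ L')) = 0
      rw [tmul_smul_tmul, ← map_smul, smul_eq_mul, mul_one,
        show Submodule.mkQ K y = 0 from (Submodule.Quotient.mk_eq_zero K).mpr hy]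
      exact TensorProduct.zero_tmul _ _
    · change ((1 : R) ⊗ₜ[k] y) • (tmul _ _ : BoxTensor k (R ⧸ K) (S ⧸ L')) = 0
      rw [tmul_smul_tmul, ← map_smul _ y, smul_eq_mul, mul_one,
        show Submodule.mkQ L' y = 0 from (Submodule.Quotient.mk_eq_zero L').mpr hy]
      exact TensorProduct.tmul_zero _ _)

lemma quotientToBox_mk (h₃ : Q ≤ extL K ⊔ extR L') (r : R) (s : S) :
    quotientToBox h₃ (Submodule.mkQ Q (r ⊗ₜ[k] s)) =
      tmul (Submodule.mkQ K r) (Submodule.mkQ L' s) := by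
  change (r ⊗ₜ[k] s) • (tmul _ _ : BoxTensor k (R ⧸ K) (S ⧸ L')) = _
  rw [tmul_smul_tmul, ← map_smul, ← map_smul, smul_eq_mul, mul_one, smul_eq_mul, mul_one]

/-- A layer of the filtration of the powers of a sum of ideals: `R / K ⊗ L / L'` is the kernel of
`(R ⊗ S) / Q → (R ⊗ S) / (Q + L)`. -/
lemma exists_layer_exact (h₁ : extL K * extR L ≤ Q) (h₂ : extR L' ≤ Q)
    (h₃ : Q ≤ extL K ⊔ extR L') (Q' : Ideal (R ⊗[k] S)) (hQ : Q ≤ Q') (hQ' : Q' = Q ⊔ extR L) :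
    ∃ g : BoxTensor k (R ⧸ K) (IdealLayer L L') →ₗ[R ⊗[k] S] (R ⊗[k] S) ⧸ Q,
      Function.Injective g ∧ Function.Exact g (Submodule.factor hQ) := by
  set σ : BoxTensor k R L →ₗ[R ⊗[k] S] BoxTensor k (R ⧸ K) (IdealLayer L L') :=
    map (Submodule.mkQ K) (Submodule.mkQ (Submodule.comap L.subtype L')) with hσ
  have hσs : Function.Surjective σ := by
    have : σ = (map (Submodule.mkQ K) (LinearMap.id : IdealLayer L L' →ₗ[S] IdealLayer L L')).comp
        (map (k := k) (LinearMap.id : R →ₗ[R] R)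
          (Submodule.mkQ (Submodule.comap L.subtype L'))) := hom_ext fun _ _ => rfl
    rw [this]
    exact (map_id_surjective _ (Submodule.mkQ_surjective _)).comp
      (id_map_surjective _ (Submodule.mkQ_surjective _))
  let g := ((LinearMap.ker σ).liftQ (layerLift L Q) (layerLift_eq_zero h₁ h₂)).comp
    (σ.quotKerEquivOfSurjective hσs).symm.toLinearMap
  have hg (z : BoxTensor k R L) : g (σ z) = layerLift L Q z := by
    have : (σ.quotKerEquivOfSurjective hσs).symm (σ z) = Submodule.Quotient.mk z :=
      (LinearEquiv.symm_apply_eq _).mpr rfl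
    change (LinearMap.ker σ).liftQ (layerLift L Q) (layerLift_eq_zero h₁ h₂)
      ((σ.quotKerEquivOfSurjective hσs).symm (σ z)) = _
    rw [this]
    rfl
  refine ⟨g, ?_, ?_⟩
  · have hcomp : (quotientToBox h₃).comp (layerLift L Q) =
        (map LinearMap.id (IdealLayer.incl L L')).comp σ := hom_ext fun r l =>
      quotientToBox_mk h₃ r l
    rw [injective_iff_map_eq_zero]
    intro x hx
    obtain ⟨z, rfl⟩ := hσs x
    rw [hg] at hx
    have := LinearMap.congr_fun hcomp z
    rw [LinearMap.comp_apply, hx, map_zero, LinearMap.comp_apply] at this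
    exact id_map_injective (R ⧸ K) (IdealLayer.incl_injective L L') (by rw [← this, map_zero])
  · have hle : extR L ≤
        LinearMap.range ((toTensor k R S).comp (map (k := k) LinearMap.id L.subtype)) :=
      Ideal.map_le_iff_le_comap.mpr fun l hl => ⟨tmul 1 ⟨l, hl⟩, rfl⟩
    intro x
    constructor
    · intro hx
      obtain ⟨x, rfl⟩ := Submodule.mkQ_surjective _ x
      have hx' : x ∈ Q' := (Submodule.Quotient.mk_eq_zero Q').mp hx
      rw [hQ'] at hx'
      obtain ⟨y, hy, w, hw, rfl⟩ := Submodule.mem_sup.mp hx'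
      obtain ⟨z, rfl⟩ := hle hw
      refine ⟨σ z, ?_⟩
      rw [hg, map_add, show Submodule.mkQ Q y = 0 from (Submodule.Quotient.mk_eq_zero Q).mpr hy,
        zero_add]
      rfl
    · rintro ⟨x, rfl⟩
      obtain ⟨z, rfl⟩ := hσs x
      rw [hg]
      have : (Submodule.factor hQ).comp (layerLift L Q) = 0 := by
        refine hom_ext fun r l => (Submodule.Quotient.mk_eq_zero Q').mpr ?_
        change r ⊗ₜ[k] (l : S) ∈ Q'
        have : (r ⊗ₜ[k] (l : S)) = r ⊗ₜ[k] 1 * 1 ⊗ₜ[k] (l : S) := by simp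
        rw [this, hQ']
        exact Ideal.mul_mem_left _ _ (Ideal.mem_sup_right (Ideal.mem_map_of_mem
          ((Algebra.TensorProduct.includeRight : S →ₐ[k] R ⊗[k] S) : S →+* R ⊗[k] S) l.2))
      exact LinearMap.congr_fun this z

end Layer

end BoxTensor

lemma Ideal.sup_pow_le {A : Type} [CommRing A] (K L : Ideal A) (c d : ℕ) :
    (K ⊔ L) ^ (c + d) ≤ K ^ c ⊔ L ^ (d + 1) := by
  rw [← Ideal.add_eq_sup, ← Ideal.add_eq_sup, add_pow]
  refine Finset.sum_induction _ (· ≤ K ^ c + L ^ (d + 1)) (fun _ _ => sup_le) bot_le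
    fun m _ => Ideal.mul_le_left.trans ?_
  rcases le_or_gt c m with h | h
  · exact Ideal.mul_le_left.trans ((Ideal.pow_le_pow_right h).trans
      (le_sup_left (b := L ^ (d + 1))))
  · have hd : d + 1 ≤ c + d - m := by lia
    exact Ideal.mul_le_right.trans ((Ideal.pow_le_pow_right hd).trans
      (le_sup_right (a := K ^ c)))

section PowerFiltration

variable {k R S : Type} [Field k] [CommRing R] [CommRing S] [Algebra k R] [Algebra k S]
  {mR : Ideal R} {mS : Ideal S} {mT : Ideal (R ⊗[k] S)} {I : Ideal R} {J : Ideal S}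
  {P : Ideal (R ⊗[k] S)}

open Algebra.TensorProduct (includeRight)

local notation "extL" => Ideal.map (algebraMap R (R ⊗[k] S))

local notation "extR" => Ideal.map ((includeRight : S →ₐ[k] R ⊗[k] S) : S →+* R ⊗[k] S)

/-- The filtration of `T / P ^ s` by the powers of the second ideal has the layers
`R / I ^ c ⊗ J ^ i / J ^ (i + 1)` with `c + i = s`. -/
lemma exists_power_layer_exact (hP : P = extL I ⊔ extR J) (c i : ℕ)
    (hle : P ^ (c + i) ⊔ extR (J ^ (i + 1)) ≤ P ^ (c + i) ⊔ extR (J ^ i)) :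
    ∃ g : BoxTensor k (R ⧸ I ^ c) (IdealLayer (J ^ i) (J ^ (i + 1))) →ₗ[R ⊗[k] S]
        (R ⊗[k] S) ⧸ (P ^ (c + i) ⊔ extR (J ^ (i + 1))),
      Function.Injective g ∧ Function.Exact g (Submodule.factor hle) := by
  refine BoxTensor.exists_layer_exact ?_ le_sup_right (sup_le ?_ le_sup_right) _ hle ?_
  · rw [Ideal.map_pow, Ideal.map_pow, pow_add]
    exact (Ideal.mul_mono (Ideal.pow_right_mono (hP ▸ le_sup_left) c)
      (Ideal.pow_right_mono (hP ▸ le_sup_right) i)).trans le_sup_left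
  · rw [Ideal.map_pow, Ideal.map_pow, hP]
    exact Ideal.sup_pow_le _ _ c i
  · have h : extR (J ^ (i + 1)) ≤ extR (J ^ i) := Ideal.map_mono (Ideal.pow_le_pow_right i.le_succ)
    rw [sup_assoc, sup_eq_right.mpr h]

lemma power_filtration_le (s i : ℕ) :
    P ^ s ⊔ extR (J ^ (i + 1)) ≤ P ^ s ⊔ extR (J ^ i) :=
  sup_le_sup_left (Ideal.map_mono (Ideal.pow_le_pow_right i.le_succ)) _

lemma extVanishes_quotient_pow_zero {A : Type} [CommRing A] (m K : Ideal A) (i : ℕ) :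
    ExtVanishes m i (A ⧸ K ^ 0) := by
  have : Subsingleton (A ⧸ K ^ 0) := by
    rw [pow_zero, Ideal.one_eq_top]
    infer_instance
  exact extVanishes_of_subsingleton m i

lemma forall_extVanishes_layer {q : ℕ}
    (hJ : ∀ t, 1 ≤ t → ∀ i < q, ExtVanishes mS i (S ⧸ J ^ t)) (t : ℕ) :
    ∀ i < q, ExtVanishes mS i (IdealLayer (J ^ t) (J ^ (t + 1))) := by
  refine IdealLayer.forall_extVanishes (Ideal.pow_le_pow_right t.le_succ) (hJ _ (by lia)) ?_
  rcases t.eq_zero_or_pos with rfl | ht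
  · exact fun i _ => extVanishes_quotient_pow_zero mS J i
  · exact hJ t ht

variable [IsNoetherianRing R] [IsNoetherianRing S]

lemma forall_extVanishes_filtration (hP : P = extL I ⊔ extR J) (hmT : mT = extL mR + extR mS)
    {p q : ℕ} (hI : ∀ c, 1 ≤ c → ∀ i < p, ExtVanishes mR i (R ⧸ I ^ c))
    (hJ : ∀ t, 1 ≤ t → ∀ i < q, ExtVanishes mS i (S ⧸ J ^ t)) {s t : ℕ} (ht : t ≤ s) :
    ∀ i < p + q, ExtVanishes mT i ((R ⊗[k] S) ⧸ (P ^ s ⊔ extR (J ^ t))) := by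
  induction t with
  | zero =>
    intro i _
    have : Subsingleton ((R ⊗[k] S) ⧸ (P ^ s ⊔ extR (J ^ 0))) := by
      rw [pow_zero, Ideal.one_eq_top, Ideal.map_top, sup_top_eq]
      infer_instance
    exact extVanishes_of_subsingleton mT i
  | succ t ih =>
    intro i hi
    obtain ⟨c, rfl⟩ := Nat.exists_eq_add_of_le' (show t ≤ s by lia)
    obtain ⟨g, hg, hge⟩ := exists_power_layer_exact hP c t (power_filtration_le (c + t) t)
    exact ExtVanishes.middle hg hge (Submodule.factor_surjective _)
      ((BoxTensor.forall_extVanishes hmT p q _ _ (hI c (by lia))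
        (forall_extVanishes_layer hJ t)).1 i hi) (ih (by lia) i hi)

lemma forall_extVanishes_quotient_sum_pow (hP : P = extL I ⊔ extR J)
    (hmT : mT = extL mR + extR mS)
    {p q : ℕ} (hI : ∀ c, 1 ≤ c → ∀ i < p, ExtVanishes mR i (R ⧸ I ^ c))
    (hJ : ∀ t, 1 ≤ t → ∀ i < q, ExtVanishes mS i (S ⧸ J ^ t)) (s : ℕ) :
    ∀ i < p + q, ExtVanishes mT i ((R ⊗[k] S) ⧸ P ^ s) := by
  have h := forall_extVanishes_filtration hP hmT hI hJ (le_refl s)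
  rwa [Ideal.map_pow, sup_eq_left.mpr (Ideal.pow_right_mono (hP ▸ le_sup_right) s)] at h

lemma extVanishes_or_of_quotient_sum_pow (hP : P = extL I ⊔ extR J)
    (hmT : mT = extL mR + extR mS)
    {p q : ℕ} (hI : ∀ c, 1 ≤ c → ∀ i < p, ExtVanishes mR i (R ⧸ I ^ c))
    (hJ : ∀ t, 1 ≤ t → ∀ i < q, ExtVanishes mS i (S ⧸ J ^ t)) (t : ℕ)
    (h : ∀ i < p + q + 1, ExtVanishes mT i ((R ⊗[k] S) ⧸ P ^ (1 + t))) :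
    ExtVanishes mR p (R ⧸ I ^ 1) ∨ ExtVanishes mS q (IdealLayer (J ^ t) (J ^ (t + 1))) := by
  obtain ⟨g, hg, hge⟩ := exists_power_layer_exact hP 1 t (power_filtration_le (1 + t) t)
  have hfilt := forall_extVanishes_filtration hP hmT hI hJ (show t ≤ 1 + t by lia)
  refine (BoxTensor.forall_extVanishes hmT p q _ _ (hI 1 le_rfl)
    (forall_extVanishes_layer hJ t)).2 (ExtVanishes.left hg hge (Submodule.factor_surjective _)
      ?_ fun i hi => hfilt i (by lia))
  have hle : extR (J ^ (t + 1)) ≤ P ^ (1 + t) := by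
    rw [Ideal.map_pow, add_comm 1 t]
    exact Ideal.pow_right_mono (hP ▸ le_sup_right) _
  rwa [sup_eq_left.mpr hle]

end PowerFiltration

end Auxiliary

/-- Let `R`, `S` be polynomial rings over a field `k`, `I ⊆ R`, `J ⊆ S` non-zero proper
monomial ideals, `T = R ⊗[k] S`, `P = I + J`.  If both `I` and `J` have constant depth
functions, then so does `P`, and `depth(T/P^s) = depth(R/I) + depth(S/J)` for all `s ≥ 1`. -/
theorem constant_depth_function_sum {a b : ℕ} {k : Type} [Field k]
    (I : Ideal (MvPolynomial (Fin a) k)) (J : Ideal (MvPolynomial (Fin b) k))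
    (hImon : IsMonomialIdeal I) (hJmon : IsMonomialIdeal J)
    (hI0 : I ≠ ⊥) (hJ0 : J ≠ ⊥) (hI1 : I ≠ ⊤) (hJ1 : J ≠ ⊤)
    (mR : Ideal (MvPolynomial (Fin a) k))
    (hmR : mR = Ideal.span (Set.range (X : Fin a → MvPolynomial (Fin a) k)))
    (mS : Ideal (MvPolynomial (Fin b) k))
    (hmS : mS = Ideal.span (Set.range (X : Fin b → MvPolynomial (Fin b) k)))
    (I' J' P mT : Ideal (MvPolynomial (Fin a) k ⊗[k] MvPolynomial (Fin b) k))
    (hI' : I' = I.map (algebraMap (MvPolynomial (Fin a) k) _))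
    (hJ' : J' = J.map ((Algebra.TensorProduct.includeRight :
      MvPolynomial (Fin b) k →ₐ[k] MvPolynomial (Fin a) k ⊗[k] MvPolynomial (Fin b) k) :
        MvPolynomial (Fin b) k →+* _))
    (hP : P = I' + J')
    (hmT : mT = mR.map (algebraMap (MvPolynomial (Fin a) k) _)
      + mS.map ((Algebra.TensorProduct.includeRight :
        MvPolynomial (Fin b) k →ₐ[k] MvPolynomial (Fin a) k ⊗[k] MvPolynomial (Fin b) k) :
          MvPolynomial (Fin b) k →+* _))
    (hconstI : ∀ s : ℕ, 1 ≤ s →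
      depthOf _ mR (MvPolynomial (Fin a) k ⧸ I ^ s) = depthOf _ mR (MvPolynomial (Fin a) k ⧸ I))
    (hconstJ : ∀ s : ℕ, 1 ≤ s →
      depthOf _ mS (MvPolynomial (Fin b) k ⧸ J ^ s) = depthOf _ mS (MvPolynomial (Fin b) k ⧸ J)) :
    ∀ s : ℕ, 1 ≤ s →
      depthOf _ mT ((MvPolynomial (Fin a) k ⊗[k] MvPolynomial (Fin b) k) ⧸ P ^ s)
        = depthOf _ mR (MvPolynomial (Fin a) k ⧸ I)
          + depthOf _ mS (MvPolynomial (Fin b) k ⧸ J) := by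
  intro s hs
  rw [hI', hJ', Ideal.add_eq_sup] at hP
  have hI (p : ℕ) (hp : (p : ℕ∞) ≤ depthOf _ mR (MvPolynomial (Fin a) k ⧸ I)) (c : ℕ)
      (hc : 1 ≤ c) := (natCast_le_depthOf_iff mR p).mp (hp.trans_eq (hconstI c hc).symm)
  have hJ (q : ℕ) (hq : (q : ℕ∞) ≤ depthOf _ mS (MvPolynomial (Fin b) k ⧸ J)) (t : ℕ)
      (ht : 1 ≤ t) := (natCast_le_depthOf_iff mS q).mp (hq.trans_eq (hconstJ t ht).symm)
  have hlower (p q : ℕ) (hp : (p : ℕ∞) ≤ depthOf _ mR (MvPolynomial (Fin a) k ⧸ I))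
      (hq : (q : ℕ∞) ≤ depthOf _ mS (MvPolynomial (Fin b) k ⧸ J)) :
      ((p + q : ℕ) : ℕ∞) ≤
        depthOf _ mT ((MvPolynomial (Fin a) k ⊗[k] MvPolynomial (Fin b) k) ⧸ P ^ s) :=
    (natCast_le_depthOf_iff mT _).mpr
      (forall_extVanishes_quotient_sum_pow hP hmT (hI p hp) (hJ q hq) s)
  generalize hdI : depthOf _ mR (MvPolynomial (Fin a) k ⧸ I) = dI at hI hlower hconstI ⊢
  generalize hdJ : depthOf _ mS (MvPolynomial (Fin b) k ⧸ J) = dJ at hJ hlower hconstJ ⊢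
  induction dI with
  | top =>
    rw [top_add]
    refine ENat.eq_top_iff_forall_ge.mpr fun r => ?_
    simpa using hlower r 0 le_top zero_le
  | coe p =>
  induction dJ with
  | top =>
    rw [add_top]
    refine ENat.eq_top_iff_forall_ge.mpr fun r => ?_
    simpa using hlower 0 r zero_le le_top
  | coe q =>
  refine le_antisymm ?_ (by simpa using hlower p q le_rfl le_rfl)
  obtain ⟨t, rfl⟩ := Nat.exists_eq_add_of_le hs
  by_contra hlt
  have hvan : ∀ i < p + q + 1, ExtVanishes mT i (_ ⧸ P ^ (1 + t)) :=
    (natCast_le_depthOf_iff mT (p + q + 1)).mp (by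
      rw [not_le] at hlt
      exact_mod_cast Order.add_one_le_of_lt hlt)
  have hnot {A M : Type} [CommRing A] [AddCommGroup M] [Module A M] {m : Ideal A} {r : ℕ}
      (hd : depthOf A m M = r) : ¬ ExtVanishes m r M := fun h => by
    have : ((r + 1 : ℕ) : ℕ∞) ≤ depthOf A m M := (natCast_le_depthOf_iff m _).mpr fun i hi => by
      rcases (Nat.lt_succ_iff_lt_or_eq.mp hi) with hi | rfl
      · exact (natCast_le_depthOf_iff m r).mp hd.ge i hi
      · exact h
    rw [hd, Nat.cast_le] at this
    lia
  rcases extVanishes_or_of_quotient_sum_pow hP hmT (hI p le_rfl) (hJ q le_rfl) t hvan with h | h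
  · exact hnot (hconstI 1 le_rfl) h
  · refine not_extVanishes_layer hJmon hJ0 hJ1 t hmS (hJ q le_rfl (t + 1) (by lia))
      (hnot (hconstJ (t + 1) (by lia))) ?_ h
    rcases t.eq_zero_or_pos with rfl | ht
    · exact fun i _ => extVanishes_quotient_pow_zero mS J i
    · exact hJ q le_rfl t ht
end
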